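/- arXiv:1910.11719 — 3 statements merged into one kernel-verified Lean document; each statement's English description precedes it below -/
import Mathlib

section
/- Let d ≥ 1, a ≥ 1, and let g ∈ C²([−2a,2a]^d) satisfy g(x) ≥ 4a on [−2a,2a]^d; let M > 10 satisfy max_{1≤i≤j≤d} ‖∂_i∂_j g‖_{L^∞([−2a,2a]^d)} ≤ M and ‖∇g(0)‖ ≤ M. Let G := {(x,y) : x ∈ (−a,a)^d, g(x) − a < y ≤ g(x)} and, for λ ∈ (1,2], G(λ) := {(x,y) : x ∈ (−λa, λa)^d, g(x) − λa < y ≤ g(x)}. For x₀ ∈ [−2a,2a]^d and 1 ≤ j ≤ d let ξ_j(x₀) := e_j + ∂_j g(x₀) e_{d+1} ∈ ℝ^{d+1}, and for a multi-index α = (α₁,…,α_d) ∈ ℤ₊^d define the mixed tangential derivative D_tan^α f(x,y) := ((ξ₁(x₀)·∇)^{α₁} ⋯ (ξ_d(x₀)·∇)^{α_d} f)(x,y) evaluated at x₀ = x (the operators applied with x₀ frozen, then evaluated at the frozen point). Set φ_n(x,y) := √(g(x) − y) + 1/n. Then for every 0 < p ≤ ∞, λ ∈ (1,2], α ∈ ℤ₊^d,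 integers i, j ≥ 0, and every polynomial f ∈ Π_n^{d+1}: ‖φ_n^i · D_tan^α ∂_{d+1}^{i+j} f‖_{L^p(G)} ≤ c · n^{|α|+i+2j} · ‖f‖_{L^p(G(λ))}, where |α| = α₁+⋯+α_d and c depends only on M, d, λ, α, i, j and p. -/
open MeasureTheory ENNReal NNReal

noncomputable section

/-- first `d` coordinates of a point of `ℝ^{d+1}` -/
def xpart {d : ℕ} (ξ : EuclideanSpace ℝ (Fin (d + 1))) : EuclideanSpace ℝ (Fin d) :=
  (EuclideanSpace.equiv (Fin d) ℝ).symm (fun i => ξ i.castSucc)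

/-- last coordinate of a point of `ℝ^{d+1}` -/
def ypart {d : ℕ} (ξ : EuclideanSpace ℝ (Fin (d + 1))) : ℝ := ξ (Fin.last d)

/-- the cube `[-c,c]^d` -/
def cube (d : ℕ) (c : ℝ) : Set (EuclideanSpace ℝ (Fin d)) :=
  {x | ∀ i, x i ∈ Set.Icc (-c) c}

/-- the mixed tangential-derivative operator
`(ξ₁(x₀)·∇)^{α₁} ⋯ (ξ_d(x₀)·∇)^{α_d}` on polynomials, with frozen slopes
`c j = ∂_j g(x₀)`, where `ξ_j(x₀) = e_j + (∂_j g(x₀)) e_{d+1}`. -/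
def tanOpD {d : ℕ} (c : Fin d → ℝ) (α : Fin d → ℕ)
    (P : MvPolynomial (Fin (d + 1)) ℝ) : MvPolynomial (Fin (d + 1)) ℝ :=
  (List.finRange d).foldl
    (fun Q j =>
      (fun Q' => MvPolynomial.pderiv (Fin.castSucc j) Q' +
        c j • MvPolynomial.pderiv (Fin.last d) Q')^[α j] Q) P

open Polynomial in
theorem norm_eval_derivative_le_of_isPrimitiveRoot {L : ℕ} {ζ : ℂ}
    (hζ : IsPrimitiveRoot ζ L) (hL : 0 < L) (Φ : ℂ[X]) (hΦ : Φ.natDegree < L) :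
    ‖Φ.derivative.eval 1‖ ≤ L * ∑ m ∈ Finset.range L, ‖Φ.eval (ζ ^ m)‖ := by
  have hL0 : (L : ℂ) ≠ 0 := by exact_mod_cast hL.ne'
  have hLR : (0 : ℝ) < L := by exact_mod_cast hL
  have hζ0 : ζ ≠ 0 := hζ.ne_zero hL.ne'
  have hζn : ‖ζ‖ = 1 := hζ.norm'_eq_one hL.ne'
  have key : ∀ k < L, (L : ℂ) * Φ.coeff k =
      ∑ m ∈ Finset.range L, Φ.eval (ζ ^ m) * ((ζ ^ k)⁻¹) ^ m := by
    intro k hk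
    have h1 : ∀ m, Φ.eval (ζ ^ m) * ((ζ ^ k)⁻¹) ^ m =
        ∑ j ∈ Finset.range L, Φ.coeff j * (ζ ^ j * (ζ ^ k)⁻¹) ^ m := by
      intro m
      rw [Polynomial.eval_eq_sum_range' hΦ, Finset.sum_mul]
      refine Finset.sum_congr rfl fun j _ => ?_
      rw [mul_pow, ← pow_mul, ← pow_mul, mul_comm m j, mul_assoc]
    simp_rw [h1]
    rw [Finset.sum_comm, Finset.sum_eq_single k]
    · simp [hζ0, mul_comm]
    · intro j hj hjk
      rw [← Finset.mul_sum]
      have hw : ζ ^ j * (ζ ^ k)⁻¹ ≠ 1 := by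
        intro h
        have : ζ ^ j = ζ ^ k := by
          field_simp at h
          exact h
        exact hjk (hζ.pow_inj (Finset.mem_range.1 hj) hk this)
      rw [geom_sum_eq hw]
      have : (ζ ^ j * (ζ ^ k)⁻¹) ^ L = 1 := by
        rw [mul_pow, inv_pow, ← pow_mul, ← pow_mul, mul_comm j, mul_comm k, pow_mul, pow_mul,
          hζ.pow_eq_one]
        simp
      simp [this]
    · intro h
      exact absurd (Finset.mem_range.2 hk) h
  set S := ∑ m ∈ Finset.range L, ‖Φ.eval (ζ ^ m)‖ with hS
  have hS0 : 0 ≤ S := Finset.sum_nonneg fun _ _ => norm_nonneg _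
  have hcoef : ∀ k < L, L * ‖Φ.coeff k‖ ≤ S := by
    intro k hk
    have := congrArg norm (key k hk)
    rw [norm_mul, Complex.norm_natCast] at this
    rw [this]
    refine (norm_sum_le _ _).trans (Finset.sum_le_sum fun m _ => ?_)
    simp [hζn]
  have hder : Φ.derivative.eval 1 = ∑ k ∈ Finset.range L, (k : ℂ) * Φ.coeff k := by
    rw [Polynomial.derivative_eval, Polynomial.sum_over_range' _ _ L hΦ]
    · simp [mul_comm]
    · simp
  rw [hder]
  calc ‖∑ k ∈ Finset.range L, (k : ℂ) * Φ.coeff k‖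
      ≤ ∑ k ∈ Finset.range L, L * ‖Φ.coeff k‖ := by
        refine (norm_sum_le _ _).trans (Finset.sum_le_sum fun k hk => ?_)
        rw [norm_mul, Complex.norm_natCast]
        gcongr
        exact (Finset.mem_range.1 hk).le
    _ ≤ ∑ k ∈ Finset.range L, S :=
        Finset.sum_le_sum fun k hk => hcoef k (Finset.mem_range.1 hk)
    _ = L * S := by simp

open Polynomial in
/-- The polynomial `z ^ N * Q (δ * (z - z⁻¹) / (2 * I))`, for `Q` of degree at most `N`. -/
def circlePoly (δ : ℝ) (N : ℕ) (Q : ℝ[X]) : ℂ[X] :=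
  ∑ k ∈ Finset.range (N + 1),
    C ((Q.coeff k : ℂ) * (δ / (2 * Complex.I)) ^ k) * ((X ^ 2 - 1) ^ k * X ^ (N - k))

open Polynomial in
theorem natDegree_circlePoly_le (δ : ℝ) (N : ℕ) (Q : ℝ[X]) :
    (circlePoly δ N Q).natDegree ≤ 2 * N := by
  refine natDegree_sum_le_of_forall_le _ _ fun k hk => ?_
  have hk : k ≤ N := Nat.lt_succ_iff.1 (Finset.mem_range.1 hk)
  refine (natDegree_C_mul_le _ _).trans (natDegree_mul_le.trans ?_)
  have h1 : ((X ^ 2 - 1 : ℂ[X]) ^ k).natDegree ≤ k * 2 := by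
    refine natDegree_pow_le.trans (Nat.mul_le_mul_left _ ?_)
    exact (natDegree_sub_le _ _).trans (by simp)
  have h2 : ((X : ℂ[X]) ^ (N - k)).natDegree ≤ N - k := by simp
  omega

open Polynomial in
theorem norm_eval_circlePoly (δ : ℝ) (N : ℕ) (Q : ℝ[X]) (hQ : Q.natDegree ≤ N) (θ : ℝ) :
    ‖(circlePoly δ N Q).eval (Complex.exp (θ * Complex.I))‖ = |Q.eval (δ * Real.sin θ)| := by
  set z := Complex.exp (θ * Complex.I) with hz
  have hz0 : z ≠ 0 := Complex.exp_ne_zero _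
  have hz1 : ‖z‖ = 1 := Complex.norm_exp_ofReal_mul_I θ
  have hsin : (z ^ 2 - 1) * (δ / (2 * Complex.I)) = z * ((δ * Real.sin θ : ℝ) : ℂ) := by
    have : z⁻¹ = Complex.exp (-θ * Complex.I) := by rw [hz, ← Complex.exp_neg]; ring_nf
    push_cast
    rw [Complex.sin, ← this, ← hz]
    field_simp
    linear_combination ( - δ + δ * z^2) * Complex.I_sq
  have h : (circlePoly δ N Q).eval z = z ^ N * ((Q.eval (δ * Real.sin θ) : ℝ) : ℂ) := by
    rw [circlePoly, eval_finsetSum, eval_eq_sum_range' (Nat.lt_succ_of_le hQ)]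
    push_cast
    rw [Finset.mul_sum]
    refine Finset.sum_congr rfl fun k hk => ?_
    have hk : k ≤ N := Nat.lt_succ_iff.1 (Finset.mem_range.1 hk)
    push_cast at hsin
    simp only [eval_mul, eval_C, eval_pow, eval_sub, eval_X, eval_one]
    rw [show (Q.coeff k : ℂ) * (δ / (2 * Complex.I)) ^ k * ((z ^ 2 - 1) ^ k * z ^ (N - k)) =
      Q.coeff k * ((z ^ 2 - 1) * (δ / (2 * Complex.I))) ^ k * z ^ (N - k) by rw [mul_pow]; ring,
      hsin, mul_pow, ← Nat.add_sub_of_le hk, pow_add]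
    simp only [Nat.add_sub_cancel_left]
    ring
  rw [h, norm_mul, norm_pow, hz1, one_pow, one_mul, Complex.norm_real, Real.norm_eq_abs]

open Polynomial in
theorem eval_one_circlePoly (δ : ℝ) (N : ℕ) (Q : ℝ[X]) :
    (circlePoly δ N Q).eval 1 = (Q.eval 0 : ℝ) := by
  rw [circlePoly, eval_finsetSum, Finset.sum_eq_single 0]
  · simp [coeff_zero_eq_eval_zero]
  · intro k _ hk
    simp [hk]
  · simp

open Polynomial in
theorem eval_one_derivative_circlePoly (δ : ℝ) (N : ℕ) (Q : ℝ[X]) (hN : 1 ≤ N) :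
    (circlePoly δ N Q).derivative.eval 1 =
      N * (Q.eval 0 : ℝ) + δ / Complex.I * (Q.derivative.eval 0 : ℝ) := by
  have h0 : Q.eval 0 = Q.coeff 0 := (coeff_zero_eq_eval_zero Q).symm
  have h1 : Q.derivative.eval 0 = Q.coeff 1 := by
    rw [← coeff_zero_eq_eval_zero, coeff_derivative]; simp
  obtain ⟨N, rfl⟩ : ∃ N', N = N' + 1 := ⟨N - 1, by omega⟩
  rw [circlePoly, derivative_sum, eval_finsetSum, Finset.sum_range_succ', Finset.sum_range_succ',
    Finset.sum_eq_zero, h0, h1]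
  · simp [derivative_pow]
    field_simp
    linear_combination (Q.coeff 1 : ℂ) * δ * Complex.I_sq
  · intro k _
    simp [derivative_pow]

theorem min_le_mul_abs_sin {L m : ℕ} (hL : 0 < L) (hm : m < L) :
    2 * (min m (L - m) : ℕ) / (L : ℝ) ≤ |Real.sin (Real.pi * m / L)| := by
  have hLR : (0 : ℝ) < L := by exact_mod_cast hL
  have aux : ∀ k : ℕ, 2 * k ≤ L → 2 * (k : ℝ) / L ≤ |Real.sin (Real.pi * k / L)| := by
    intro k hk
    have hk' : 2 * (k : ℝ) ≤ L := by exact_mod_cast hk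
    have h := Real.mul_abs_le_abs_sin (x := Real.pi * k / L) (by
      rw [abs_of_nonneg (by positivity), div_le_div_iff₀ hLR two_pos]
      nlinarith [Real.pi_pos])
    rw [abs_of_nonneg (by positivity)] at h
    refine le_trans (le_of_eq ?_) h
    field_simp
  rcases le_total m (L - m) with h | h
  · rw [min_eq_left h]
    exact aux m (by omega)
  · rw [min_eq_right h]
    have := aux (L - m) (by omega)
    rw [Nat.cast_sub hm.le] at this ⊢
    rwa [show Real.pi * ((L : ℝ) - m) / L = Real.pi - Real.pi * m / L by field_simp,
      Real.sin_pi_sub] at this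

theorem abs_sin_le_min {L m : ℕ} (hL : 0 < L) (hm : m < L) :
    |Real.sin (2 * Real.pi * m / L)| ≤ 2 * Real.pi * (min m (L - m) : ℕ) / L := by
  have hLR : (0 : ℝ) < L := by exact_mod_cast hL
  have aux : ∀ k : ℕ, |Real.sin (2 * Real.pi * k / L)| ≤ 2 * Real.pi * (k : ℝ) / L := by
    intro k
    refine Real.abs_sin_le_abs.trans (le_of_eq (abs_of_nonneg (by positivity)))
  rcases le_total m (L - m) with h | h
  · rw [min_eq_left h]
    exact aux m
  · rw [min_eq_right h]
    have := aux (L - m)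
    rw [Nat.cast_sub hm.le] at this ⊢
    have e : 2 * Real.pi * ((L : ℝ) - m) / L = 2 * Real.pi - 2 * Real.pi * m / L := by field_simp
    have e' : |Real.sin (2 * Real.pi * ((L : ℝ) - m) / L)| =
        |Real.sin (2 * Real.pi * m / L)| := by
      rw [e, Real.sin_two_pi_sub, abs_neg]
    rwa [e'] at this

open Polynomial in
/-- The normalised geometric sum `(1 + z + ⋯ + z ^ (n - 1)) / n`. -/
def avgPoly (n : ℕ) : ℂ[X] := C ((n : ℂ)⁻¹) * ∑ k ∈ Finset.range n, X ^ k

open Polynomial in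
theorem natDegree_avgPoly_le (n : ℕ) : (avgPoly n).natDegree ≤ n := by
  refine (natDegree_C_mul_le _ _).trans (natDegree_sum_le_of_forall_le _ _ fun k hk => ?_)
  simpa using (Finset.mem_range.1 hk).le

theorem eval_one_avgPoly {n : ℕ} (hn : 0 < n) : (avgPoly n).eval 1 = 1 := by
  have : (n : ℂ) ≠ 0 := by exact_mod_cast hn.ne'
  simp [avgPoly, Polynomial.eval_finsetSum, this]

theorem norm_eval_one_derivative_avgPoly_le {n : ℕ} (hn : 0 < n) :
    ‖(avgPoly n).derivative.eval 1‖ ≤ n := by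
  have hnR : (0 : ℝ) < n := by exact_mod_cast hn
  have : (avgPoly n).derivative.eval 1 = (n : ℂ)⁻¹ * ∑ k ∈ Finset.range n, (k : ℂ) := by
    simp [avgPoly, Polynomial.eval_finsetSum, Polynomial.derivative_X_pow]
  rw [this, norm_mul, norm_inv, Complex.norm_natCast]
  have h : ‖∑ k ∈ Finset.range n, (k : ℂ)‖ ≤ n * n := by
    calc ‖∑ k ∈ Finset.range n, (k : ℂ)‖ ≤ ∑ k ∈ Finset.range n, (n : ℝ) := by
          refine (norm_sum_le _ _).trans (Finset.sum_le_sum fun k hk => ?_)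
          rw [Complex.norm_natCast]
          exact_mod_cast (Finset.mem_range.1 hk).le
      _ = n * n := by simp
  calc (n : ℝ)⁻¹ * ‖∑ k ∈ Finset.range n, (k : ℂ)‖ ≤ (n : ℝ)⁻¹ * (n * n) := by gcongr
    _ = n := by field_simp

theorem norm_eval_avgPoly_le_one {n : ℕ} (hn : 0 < n) {z : ℂ} (hz : ‖z‖ = 1) :
    ‖(avgPoly n).eval z‖ ≤ 1 := by
  have hnR : (0 : ℝ) < n := by exact_mod_cast hn
  have h : ‖∑ k ∈ Finset.range n, z ^ k‖ ≤ n := by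
    refine (norm_sum_le _ _).trans (le_of_eq ?_)
    simp [hz]
  simp only [avgPoly, Polynomial.eval_mul, Polynomial.eval_C, Polynomial.eval_finsetSum,
    Polynomial.eval_pow, Polynomial.eval_X, norm_mul, norm_inv, Complex.norm_natCast]
  calc (n : ℝ)⁻¹ * ‖∑ k ∈ Finset.range n, z ^ k‖ ≤ (n : ℝ)⁻¹ * n := by gcongr
    _ = 1 := by field_simp

theorem norm_eval_avgPoly_mul_le {n : ℕ} (hn : 0 < n) {z : ℂ} (hz : ‖z‖ = 1) :
    ‖(avgPoly n).eval z‖ * (n * ‖z - 1‖) ≤ 2 := by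
  have hnC : (n : ℂ) ≠ 0 := by exact_mod_cast hn.ne'
  have h : (avgPoly n).eval z * (n * (z - 1)) = z ^ n - 1 := by
    rw [← geom_sum_mul]
    simp only [avgPoly, Polynomial.eval_mul, Polynomial.eval_C, Polynomial.eval_finsetSum,
      Polynomial.eval_pow, Polynomial.eval_X]
    field_simp
  have h2 := congrArg norm h
  rw [norm_mul, norm_mul, Complex.norm_natCast] at h2
  rw [h2]
  refine (norm_sub_le _ _).trans ?_
  simp [hz]
  norm_num

/-- At the `κ n`-th roots of unity, `avgPoly n` decays like the inverse of the index distance. -/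
theorem norm_eval_avgPoly_root_le {n κ m : ℕ} (hn : 0 < n) (hκ : 1 ≤ κ) (hm : m < κ * n) :
    ‖(avgPoly n).eval (Complex.exp ((2 * Real.pi * m / (κ * n : ℕ) : ℝ) * Complex.I))‖ ≤
      κ / ((min m (κ * n - m) : ℕ) + 1 : ℝ) := by
  set θ : ℝ := 2 * Real.pi * m / (κ * n : ℕ) with hθ
  set μ := min m (κ * n - m) with hμ
  set z := Complex.exp (θ * Complex.I)
  have hz : ‖z‖ = 1 := Complex.norm_exp_ofReal_mul_I θ
  have hL : 0 < κ * n := by positivity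
  have hnR : (0 : ℝ) < n := by exact_mod_cast hn
  have hκR : (1 : ℝ) ≤ κ := by exact_mod_cast hκ
  have h1 := norm_eval_avgPoly_le_one hn hz
  have h2 := norm_eval_avgPoly_mul_le hn hz
  have h3 : ‖z - 1‖ = 2 * |Real.sin (Real.pi * m / (κ * n : ℕ))| := by
    have := Complex.norm_exp_I_mul_ofReal_sub_one θ
    rw [mul_comm] at this
    rw [this, Real.norm_eq_abs, abs_mul, abs_two, hθ]
    congr 3
    ring
  have h4 := min_le_mul_abs_sin hL hm
  rw [← hμ] at h4
  set w := ‖(avgPoly n).eval z‖ with hw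
  have hw0 : 0 ≤ w := norm_nonneg _
  rw [h3] at h2
  have h5 : w * (4 * μ) ≤ 2 * κ := by
    have : w * (n * (2 * (2 * μ / (κ * n : ℕ)))) ≤ 2 := by
      refine le_trans ?_ h2
      gcongr
    push_cast at this
    have e : w * (n * (2 * (2 * μ / (κ * n)))) = w * (4 * μ) / κ := by field_simp; ring
    rw [e, div_le_iff₀ (by linarith)] at this
    exact this
  rw [le_div_iff₀ (by positivity)]
  rcases Nat.eq_zero_or_pos μ with h | h
  · rw [h]; push_cast; linarith
  · have : (1 : ℝ) ≤ μ := by exact_mod_cast h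
    nlinarith

open Polynomial in
theorem abs_derivative_le_sum_nodes {δ : ℝ} (hδ : 0 < δ) (s n : ℕ) (hn : 0 < n) (Q : ℝ[X])
    (hQ : Q.natDegree ≤ 2 * n) :
    |Q.derivative.eval 0| ≤ n * ∑ m ∈ Finset.range ((5 + s) * n),
      (2 * (5 + s) / δ * ‖(avgPoly n).eval
        (Complex.exp ((2 * Real.pi * m / ((5 + s) * n : ℕ) : ℝ) * Complex.I))‖ ^ s) *
        |Q.eval (δ * Real.sin (2 * Real.pi * m / ((5 + s) * n : ℕ)))| := by
  set L := (5 + s) * n with hLdef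
  have hL : 0 < L := by positivity
  have hnR : (0 : ℝ) < n := by exact_mod_cast hn
  set ζ := Complex.exp (2 * Real.pi * Complex.I / L) with hζdef
  have hζ : IsPrimitiveRoot ζ L := Complex.isPrimitiveRoot_exp L hL.ne'
  have hpow : ∀ m : ℕ, ζ ^ m = Complex.exp ((2 * Real.pi * m / (L : ℕ) : ℝ) * Complex.I) := by
    intro m
    rw [hζdef, ← Complex.exp_nat_mul]
    congr 1
    push_cast
    ring
  set Φ := circlePoly δ (2 * n) Q * avgPoly n ^ s with hΦ
  have hdeg : Φ.natDegree < L := by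
    have h1 := natDegree_circlePoly_le δ (2 * n) Q
    have h2 : (avgPoly n ^ s).natDegree ≤ s * n :=
      natDegree_pow_le.trans (Nat.mul_le_mul_left _ (natDegree_avgPoly_le n))
    have h3 : Φ.natDegree ≤ _ := natDegree_mul_le
    have : L = 5 * n + s * n := by rw [hLdef]; ring
    omega
  have hmain := norm_eval_derivative_le_of_isPrimitiveRoot hζ hL Φ hdeg
  set T : ℕ → ℝ := fun m => ‖(avgPoly n).eval
        (Complex.exp ((2 * Real.pi * m / (L : ℕ) : ℝ) * Complex.I))‖ ^ s *
        |Q.eval (δ * Real.sin (2 * Real.pi * m / (L : ℕ)))| with hT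
  have hsum : ∑ m ∈ Finset.range L, ‖Φ.eval (ζ ^ m)‖ = ∑ m ∈ Finset.range L, T m := by
    refine Finset.sum_congr rfl fun m _ => ?_
    rw [hΦ, eval_mul, norm_mul, hpow, norm_eval_circlePoly _ _ _ hQ, eval_pow, norm_pow, mul_comm]
  have hT0 : T 0 = |Q.eval 0| := by simp [hT, eval_one_avgPoly hn]
  have hTnn : ∀ m, 0 ≤ T m := fun m => by positivity
  have hle : |Q.eval 0| ≤ ∑ m ∈ Finset.range L, T m := by
    rw [← hT0]
    exact Finset.single_le_sum (fun m _ => hTnn m) (Finset.mem_range.2 hL)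
  have hder : Φ.derivative.eval 1 = (2 * n : ℕ) * (Q.eval 0 : ℝ) +
      δ / Complex.I * (Q.derivative.eval 0 : ℝ) +
        (Q.eval 0 : ℝ) * (s * (avgPoly n).derivative.eval 1) := by
    rw [hΦ, derivative_mul, eval_add, eval_mul, eval_mul, eval_one_derivative_circlePoly _ _ _
      (by omega), eval_one_circlePoly, derivative_pow]
    simp [eval_one_avgPoly hn]
  have hA := norm_eval_one_derivative_avgPoly_le hn
  have h1 : δ * |Q.derivative.eval 0| ≤
      L * (∑ m ∈ Finset.range L, T m) + (2 + s) * n * |Q.eval 0| := by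
    have e : (δ / Complex.I * (Q.derivative.eval 0 : ℝ) : ℂ) = Φ.derivative.eval 1 -
      ((2 * n : ℕ) * (Q.eval 0 : ℝ) +
        (Q.eval 0 : ℝ) * (s * (avgPoly n).derivative.eval 1)) := by rw [hder]; ring
    have e2 := congrArg norm e
    rw [norm_mul, norm_div, Complex.norm_I, Complex.norm_real, Complex.norm_real, div_one,
      Real.norm_eq_abs, Real.norm_eq_abs, abs_of_pos hδ] at e2
    rw [e2]
    refine (norm_sub_le _ _).trans ?_
    rw [← hsum]
    refine add_le_add hmain ((norm_add_le _ _).trans ?_)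
    rw [norm_mul, norm_mul, norm_mul, Complex.norm_natCast, Complex.norm_natCast,
      Complex.norm_real, Real.norm_eq_abs]
    push_cast
    have := mul_le_mul_of_nonneg_left hA (show 0 ≤ |Q.eval 0| * s by positivity)
    linarith
  have h2 : δ * |Q.derivative.eval 0| ≤ 2 * ((5 + s) * n) * ∑ m ∈ Finset.range L, T m := by
    have : (L : ℝ) = (5 + s) * n := by rw [hLdef]; push_cast; ring
    rw [this] at h1
    have h3 : (2 + s) * n * |Q.eval 0| ≤ (5 + s) * n * ∑ m ∈ Finset.range L, T m := by
      gcongr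
      norm_num
    linarith
  have h3 : |Q.derivative.eval 0| ≤ (2 * ((5 + s) * n) * ∑ m ∈ Finset.range L, T m) / δ := by
    rw [le_div_iff₀ hδ]; linarith
  refine h3.trans (le_of_eq ?_)
  simp only [mul_assoc (2 * (5 + (s : ℝ)) / δ)]
  rw [← Finset.mul_sum]
  ring

theorem exists_derivative_nodes {δ q : ℝ} (hδ : 0 < δ) (hq : 0 < q) (e : ℕ) :
    ∃ C : ℝ, 0 ≤ C ∧ ∀ n : ℕ, 0 < n → ∃ (K : ℕ) (u b : Fin K → ℝ),
      (∀ k, |u k| ≤ δ) ∧ (∀ k, 0 ≤ b k) ∧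
      ∑ k, (b k * (1 + n * |u k|) ^ e) ^ q ≤ C ∧
      ∀ Q : Polynomial ℝ, Q.natDegree ≤ 2 * n →
        |Q.derivative.eval 0| ≤ n * ∑ k, b k * |Q.eval (u k)| := by
  obtain ⟨s, hs⟩ : ∃ s : ℕ, 2 / q ≤ s := exists_nat_ge _
  set r := e + s with hr
  set κ := 5 + r with hκ
  set S : ℝ := ∑' k : ℕ, 1 / ((k : ℝ) + 1) ^ 2 with hS
  have hsum : Summable fun k : ℕ => 1 / ((k : ℝ) + 1) ^ 2 := by
    have := (_root_.summable_nat_add_iff 1).2 (Real.summable_one_div_nat_pow.2 one_lt_two)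
    simpa using this
  have hS0 : 0 ≤ S := tsum_nonneg fun k => by positivity
  set C₀ : ℝ := 2 * κ / δ * (κ : ℝ) ^ r * (1 + 2 * Real.pi * δ) ^ e with hC₀
  have hC₀0 : 0 ≤ C₀ := by have := Real.pi_pos; positivity
  refine ⟨C₀ ^ q * (2 * S), by positivity, fun n hn => ?_⟩
  have hnR : (0 : ℝ) < n := by exact_mod_cast hn
  set L := κ * n with hL
  have hL0 : 0 < L := by positivity
  set u : ℕ → ℝ := fun m => δ * Real.sin (2 * Real.pi * m / L) with hu
  set w : ℕ → ℝ := fun m => ‖(avgPoly n).eval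
    (Complex.exp ((2 * Real.pi * m / (L : ℕ) : ℝ) * Complex.I))‖ with hw
  set b : ℕ → ℝ := fun m => 2 * (5 + r) / δ * w m ^ r with hb
  have hκc : (κ : ℝ) = 5 + r := by rw [hκ]; push_cast; ring
  refine ⟨L, fun k => u k, fun k => b k, fun k => ?_, fun k => by positivity, ?_, fun Q hQ => ?_⟩
  · simp only [hu]
    rw [abs_mul, abs_of_pos hδ]
    exact mul_le_of_le_one_right hδ.le (Real.abs_sin_le_one _)
  · have hterm : ∀ m < L, (b m * (1 + n * |u m|) ^ e) ^ q ≤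
        C₀ ^ q * (1 / ((min m (L - m) : ℕ) + 1 : ℝ) ^ 2) := by
      intro m hm
      set μ : ℕ := min m (L - m) with hμ
      have hμ0 : (0 : ℝ) ≤ μ := by positivity
      have h1 : w m ≤ κ / (μ + 1) := norm_eval_avgPoly_root_le hn (by omega) hm
      have h2 : 1 + n * |u m| ≤ (1 + 2 * Real.pi * δ) * (μ + 1) := by
        have h3 := abs_sin_le_min hL0 hm
        rw [← hμ] at h3
        have h4 : n * |u m| ≤ 2 * Real.pi * δ * μ := by
          simp only [hu]
          rw [abs_mul, abs_of_pos hδ]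
          calc n * (δ * |Real.sin (2 * Real.pi * m / L)|)
              ≤ n * (δ * (2 * Real.pi * μ / L)) := by gcongr
            _ = 2 * Real.pi * δ * μ / κ := by rw [hL]; push_cast; field_simp
            _ ≤ 2 * Real.pi * δ * μ := by
              have := Real.pi_pos
              apply div_le_self (by positivity)
              rw [hκc]
              have : (0 : ℝ) ≤ r := by positivity
              linarith
        nlinarith [Real.pi_pos, mul_pos Real.pi_pos hδ]
      have h3 : b m * (1 + n * |u m|) ^ e ≤ C₀ * (1 / (μ + 1 : ℝ) ^ s) := by
        have hpi := Real.pi_pos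
        calc b m * (1 + n * |u m|) ^ e
            ≤ (2 * (5 + r) / δ * (κ / (μ + 1)) ^ r) * ((1 + 2 * Real.pi * δ) * (μ + 1)) ^ e := by
              simp only [hb]
              have : 0 ≤ w m := norm_nonneg _
              gcongr
          _ = C₀ * (1 / (μ + 1 : ℝ) ^ s) := by
              rw [hC₀, hκc, div_pow, mul_pow, hr, pow_add (μ + 1 : ℝ)]
              field_simp
      calc (b m * (1 + n * |u m|) ^ e) ^ q ≤ (C₀ * (1 / (μ + 1 : ℝ) ^ s)) ^ q := by
            apply Real.rpow_le_rpow _ h3 hq.le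
            have : 0 ≤ w m := norm_nonneg _
            positivity
        _ = C₀ ^ q * (1 / (μ + 1 : ℝ) ^ s) ^ q := Real.mul_rpow hC₀0 (by positivity)
        _ ≤ C₀ ^ q * (1 / (μ + 1 : ℝ) ^ 2) := by
            refine mul_le_mul_of_nonneg_left ?_ (Real.rpow_nonneg hC₀0 q)
            rw [Real.div_rpow (by positivity) (by positivity), Real.one_rpow,
              ← Real.rpow_natCast, ← Real.rpow_mul (by positivity)]
            refine one_div_le_one_div_of_le (by positivity) ?_
            rw [← Real.rpow_natCast (_ + 1) 2]
            refine Real.rpow_le_rpow_of_exponent_le (by linarith) ?_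
            rw [div_le_iff₀ hq] at hs
            exact_mod_cast hs
    have hle : ∀ m < L, (1 / ((min m (L - m) : ℕ) + 1 : ℝ) ^ 2) ≤
        1 / ((m : ℝ) + 1) ^ 2 + 1 / (((L - 1 - m : ℕ) : ℝ) + 1) ^ 2 := by
      intro m hm
      rcases le_total m (L - m) with h | h
      · rw [min_eq_left h]
        have : 0 ≤ 1 / (((L - 1 - m : ℕ) : ℝ) + 1) ^ 2 := by positivity
        linarith
      · rw [min_eq_right h]
        have h1 : 0 ≤ 1 / ((m : ℝ) + 1) ^ 2 := by positivity
        have h2 : 1 / (((L - m : ℕ) : ℝ) + 1) ^ 2 ≤ 1 / (((L - 1 - m : ℕ) : ℝ) + 1) ^ 2 := by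
          gcongr
          omega
        linarith
    rw [Fin.sum_univ_eq_sum_range (fun m => (b m * (1 + n * |u m|) ^ e) ^ q) L]
    calc ∑ m ∈ Finset.range L, (b m * (1 + n * |u m|) ^ e) ^ q
        ≤ ∑ m ∈ Finset.range L, C₀ ^ q *
            (1 / ((m : ℝ) + 1) ^ 2 + 1 / (((L - 1 - m : ℕ) : ℝ) + 1) ^ 2) := by
          refine Finset.sum_le_sum fun m hm => (hterm m (Finset.mem_range.1 hm)).trans ?_
          exact mul_le_mul_of_nonneg_left (hle m (Finset.mem_range.1 hm))
            (Real.rpow_nonneg hC₀0 q)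
      _ = C₀ ^ q * (2 * ∑ m ∈ Finset.range L, 1 / ((m : ℝ) + 1) ^ 2) := by
          rw [← Finset.mul_sum, Finset.sum_add_distrib,
            Finset.sum_range_reflect (fun k => 1 / ((k : ℝ) + 1) ^ 2) L]
          ring
      _ ≤ C₀ ^ q * (2 * S) := by
          have := hsum.sum_le_tsum (Finset.range L) (fun k _ => by positivity)
          gcongr
  · refine (abs_derivative_le_sum_nodes hδ r n hn Q hQ).trans (le_of_eq ?_)
    rw [Fin.sum_univ_eq_sum_range (fun m => b m * |Q.eval (u m)|) L]

/-- The exponent for which `eLpNorm · p μ ^ q` is subadditive. -/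
def subaddExp (p : ℝ≥0∞) : ℝ := (min p 1).toReal

theorem subaddExp_pos {p : ℝ≥0∞} (hp : p ≠ 0) : 0 < subaddExp p :=
  ENNReal.toReal_pos (by simp [hp]) (by simp)

theorem subaddExp_le_one (p : ℝ≥0∞) : subaddExp p ≤ 1 := by
  have := ENNReal.toReal_mono ENNReal.one_ne_top (min_le_right p 1)
  simpa [subaddExp] using this

theorem subaddExp_of_one_le {p : ℝ≥0∞} (hp : 1 ≤ p) : subaddExp p = 1 := by
  simp [subaddExp, min_eq_right hp]

theorem subaddExp_of_le_one {p : ℝ≥0∞} (hp : p ≤ 1) : subaddExp p = p.toReal := by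
  simp [subaddExp, min_eq_left hp]

theorem subaddExp_mul_le_one (p : ℝ≥0∞) : (1 / p).toReal * subaddExp p ≤ 1 := by
  rcases le_total 1 p with h | h
  · rw [subaddExp_of_one_le h, mul_one]
    have := ENNReal.toReal_mono ENNReal.one_ne_top (ENNReal.div_le_of_le_mul (by simpa using h))
    simpa using this
  · rw [subaddExp_of_le_one h, ← ENNReal.toReal_mul]
    have := ENNReal.toReal_mono ENNReal.one_ne_top (show 1 / p * p ≤ 1 by
      rw [one_div]; exact ENNReal.inv_mul_le_one p)
    simpa using this

section Norms

variable {X : Type*} [MeasurableSpace X] {μ : Measure X}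

theorem eLpNorm_add_rpow_le {p : ℝ≥0∞} (hp : p ≠ 0) {f g : X → ℝ}
    (hf : AEStronglyMeasurable f μ) (hg : AEStronglyMeasurable g μ) :
    eLpNorm (f + g) p μ ^ subaddExp p ≤
      eLpNorm f p μ ^ subaddExp p + eLpNorm g p μ ^ subaddExp p := by
  rcases le_total 1 p with h | h
  · rw [subaddExp_of_one_le h]
    simpa using eLpNorm_add_le hf hg h
  · rw [subaddExp_of_le_one h]
    have hpt : p ≠ ∞ := ne_top_of_le_ne_top ENNReal.one_ne_top h
    have hp0 : 0 < p.toReal := ENNReal.toReal_pos hp hpt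
    have hp1 : p.toReal ≤ 1 := by
      simpa using ENNReal.toReal_mono ENNReal.one_ne_top h
    have key : ∀ F : X → ℝ, eLpNorm F p μ ^ p.toReal = ∫⁻ x, ‖F x‖ₑ ^ p.toReal ∂μ := by
      intro F
      rw [eLpNorm_eq_lintegral_rpow_enorm_toReal hp hpt, ← ENNReal.rpow_mul,
        one_div, inv_mul_cancel₀ hp0.ne', ENNReal.rpow_one]
    rw [key, key, key, ← lintegral_add_left' (hf.enorm.pow_const _)]
    refine lintegral_mono fun x => ?_
    refine le_trans ?_ (ENNReal.rpow_add_le_add_rpow _ _ hp0.le hp1)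
    exact ENNReal.rpow_le_rpow (enorm_add_le _ _) hp0.le

theorem eLpNorm_sum_rpow_le {p : ℝ≥0∞} (hp : p ≠ 0) {ι : Type*} (s : Finset ι) {f : ι → X → ℝ}
    (hf : ∀ k ∈ s, AEStronglyMeasurable (f k) μ) :
    eLpNorm (∑ k ∈ s, f k) p μ ^ subaddExp p ≤ ∑ k ∈ s, eLpNorm (f k) p μ ^ subaddExp p := by
  classical
  induction s using Finset.induction_on with
  | empty => simp [subaddExp_pos hp]
  | insert a s ha ih =>
    rw [Finset.sum_insert ha, Finset.sum_insert ha]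
    refine (eLpNorm_add_rpow_le hp (hf a (by simp)) ?_).trans ?_
    · exact Finset.aestronglyMeasurable_sum s fun k hk => hf k (by simp [hk])
    · gcongr
      exact ih fun k hk => hf k (by simp [hk])

theorem eLpNorm_comp_le_of_map_le {p : ℝ≥0∞} {A A' : Set X} {T : X → X} {N : ℕ}
    (hT : Measurable T) (hN1 : 1 ≤ N)
    (hN : Measure.map T (μ.restrict A) ≤ (N : ℝ≥0∞) • μ.restrict A')
    {F : X → ℝ} (hF : Measurable F) :
    eLpNorm (F ∘ T) p (μ.restrict A) ≤
      (N : ℝ≥0∞) ^ (1 / p).toReal * eLpNorm F p (μ.restrict A') := by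
  rw [← eLpNorm_map_measure hF.aestronglyMeasurable hT.aemeasurable]
  refine (eLpNorm_mono_measure F hN).trans (le_of_eq ?_)
  rw [eLpNorm_smul_measure_of_ne_zero (by exact_mod_cast (by omega : N ≠ 0)), smul_eq_mul]

/-- A pointwise bound by compositions with maps of controlled multiplicity gives a norm bound. -/
theorem eLpNorm_le_of_pointwise {p : ℝ≥0∞} (hp : p ≠ 0) {A A' : Set X} (hA : MeasurableSet A)
    {ι : Type*} [Fintype ι] {T : ι → X → X} {b D : ι → ℝ} {N : ι → ℕ} {F : X → ℝ}
    {G : ι → X → ℝ} (hG : ∀ k, Measurable (G k)) (hT : ∀ k, Measurable (T k))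
    (hN1 : ∀ k, 1 ≤ N k)
    (hN : ∀ k, Measure.map (T k) (μ.restrict A) ≤ (N k : ℝ≥0∞) • μ.restrict A')
    (hb : ∀ k, 0 ≤ b k) (hD : ∀ k, 0 ≤ D k)
    (hF : ∀ q ∈ A, |F q| ≤ ∑ k, b k * |G k (T k q)|) {Y : ℝ≥0∞} {C : ℝ}
    (hY : ∀ k, eLpNorm (G k) p (μ.restrict A') ≤ ENNReal.ofReal (D k) * Y)
    (hC : ∑ k, (b k * D k) ^ subaddExp p * N k ≤ C) :
    eLpNorm F p (μ.restrict A) ≤ ENNReal.ofReal (C ^ (1 / subaddExp p)) * Y := by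
  set q := subaddExp p with hqdef
  have hq : 0 < q := subaddExp_pos hp
  have hC0 : 0 ≤ C := le_trans (Finset.sum_nonneg fun k _ => by
    have := hb k; have := hD k; positivity) hC
  set f : ι → X → ℝ := fun k x => b k * |G k (T k x)| with hf
  have hfm : ∀ k, Measurable (f k) := fun k => by
    have := ((hG k).comp (hT k)).norm.const_mul (b k)
    simpa [hf] using this
  have h1 : eLpNorm F p (μ.restrict A) ≤ eLpNorm (∑ k, f k) p (μ.restrict A) := by
    refine eLpNorm_mono_ae_real (ae_restrict_of_forall_mem hA fun x hx => ?_)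
    simpa [hf, Finset.sum_apply] using hF x hx
  have h2 : ∀ k, eLpNorm (f k) p (μ.restrict A) ^ q ≤
      ENNReal.ofReal ((b k * D k) ^ q * N k) * Y ^ q := by
    intro k
    have e1 : eLpNorm (f k) p (μ.restrict A) =
        ENNReal.ofReal (b k) * eLpNorm (G k ∘ T k) p (μ.restrict A) := by
      have : f k = b k • fun x => ‖(G k ∘ T k) x‖ := by
        ext x; simp [hf]
      rw [this, eLpNorm_const_smul, eLpNorm_norm, Real.enorm_eq_ofReal (hb k)]
    have e2 := eLpNorm_comp_le_of_map_le (p := p) (hT k) (hN1 k) (hN k) (hG k)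
    have e3 : ((N k : ℝ≥0∞) ^ (1 / p).toReal) ^ q ≤ N k := by
      rw [← ENNReal.rpow_mul]
      calc (N k : ℝ≥0∞) ^ ((1 / p).toReal * q) ≤ (N k : ℝ≥0∞) ^ (1 : ℝ) :=
            ENNReal.rpow_le_rpow_of_exponent_le (by exact_mod_cast hN1 k)
              (subaddExp_mul_le_one p)
        _ = N k := ENNReal.rpow_one _
    calc eLpNorm (f k) p (μ.restrict A) ^ q
        ≤ (ENNReal.ofReal (b k) * ((N k : ℝ≥0∞) ^ (1 / p).toReal *
            (ENNReal.ofReal (D k) * Y))) ^ q := by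
          rw [e1]
          refine ENNReal.rpow_le_rpow ?_ hq.le
          gcongr
          refine e2.trans ?_
          gcongr
          exact hY k
      _ = (ENNReal.ofReal (b k) * ENNReal.ofReal (D k)) ^ q *
            ((N k : ℝ≥0∞) ^ (1 / p).toReal) ^ q * Y ^ q := by
          rw [← ENNReal.mul_rpow_of_nonneg _ _ hq.le, ← ENNReal.mul_rpow_of_nonneg _ _ hq.le]
          ring_nf
      _ ≤ (ENNReal.ofReal (b k) * ENNReal.ofReal (D k)) ^ q * N k * Y ^ q := by gcongr
      _ = _ := by
          rw [← ENNReal.ofReal_mul (hb k), ENNReal.ofReal_rpow_of_nonneg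
            (mul_nonneg (hb k) (hD k)) hq.le, ENNReal.ofReal_mul
            (Real.rpow_nonneg (mul_nonneg (hb k) (hD k)) q), ENNReal.ofReal_natCast]
  have h3 : eLpNorm F p (μ.restrict A) ^ q ≤ ENNReal.ofReal C * Y ^ q := by
    calc eLpNorm F p (μ.restrict A) ^ q ≤ eLpNorm (∑ k, f k) p (μ.restrict A) ^ q :=
          ENNReal.rpow_le_rpow h1 hq.le
      _ ≤ ∑ k, eLpNorm (f k) p (μ.restrict A) ^ q :=
          eLpNorm_sum_rpow_le hp _ fun k _ => (hfm k).aestronglyMeasurable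
      _ ≤ ∑ k, ENNReal.ofReal ((b k * D k) ^ q * N k) * Y ^ q :=
          Finset.sum_le_sum fun k _ => h2 k
      _ = ENNReal.ofReal (∑ k, (b k * D k) ^ q * N k) * Y ^ q := by
          rw [← Finset.sum_mul, ENNReal.ofReal_sum_of_nonneg]
          intro k _
          have := hb k; have := hD k
          positivity
      _ ≤ ENNReal.ofReal C * Y ^ q := by gcongr
  calc eLpNorm F p (μ.restrict A) = (eLpNorm F p (μ.restrict A) ^ q) ^ (1 / q) := by
        rw [← ENNReal.rpow_mul, mul_one_div_cancel hq.ne', ENNReal.rpow_one]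
    _ ≤ (ENNReal.ofReal C * Y ^ q) ^ (1 / q) := ENNReal.rpow_le_rpow h3 (by positivity)
    _ = ENNReal.ofReal (C ^ (1 / q)) * Y := by
        rw [ENNReal.mul_rpow_of_nonneg _ _ (by positivity), ← ENNReal.rpow_mul,
          mul_one_div_cancel hq.ne', ENNReal.rpow_one,
          ENNReal.ofReal_rpow_of_nonneg hC0 (by positivity)]

theorem map_restrict_le_of_measurePreserving {A A' : Set X} (hA' : MeasurableSet A')
    {T : X → X} (hT : MeasurePreserving T μ μ) (hAA : ∀ q ∈ A, T q ∈ A') :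
    Measure.map T (μ.restrict A) ≤ ((1 : ℕ) : ℝ≥0∞) • μ.restrict A' := by
  rw [Nat.cast_one, one_smul, ← (hT.restrict_preimage hA').map_eq]
  exact Measure.map_mono (Measure.restrict_mono (fun q hq => hAA q hq) le_rfl) hT.measurable

/-- A piecewise translation whose fibres have at most `N` points. -/
theorem map_restrict_le_of_piecewise_translation {E : Type*} [AddCommGroup E] [MeasurableSpace E]
    [MeasurableAdd E] {μ : Measure E} [μ.IsAddRightInvariant] {A A' : Set E}
    (hA : MeasurableSet A) (hA' : MeasurableSet A') {idx : E → ℕ} (hidx : Measurable idx)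
    (v : ℕ → E) {N : ℕ} (hAA : ∀ q ∈ A, q + v (idx q) ∈ A')
    (hN : ∀ q', ∃ s : Finset ℕ, s.card ≤ N ∧
      ∀ q ∈ A, q + v (idx q) = q' → idx q ∈ s) :
    Measure.map (fun q => q + v (idx q)) (μ.restrict A) ≤ (N : ℝ≥0∞) • μ.restrict A' := by
  have hT : Measurable fun q => q + v (idx q) := by
    have : Measurable fun x : E × ℕ => x.1 + v x.2 :=
      measurable_from_prod_countable_left fun l => measurable_id.add_const (v l)
    exact this.comp (measurable_id.prodMk hidx)
  refine Measure.le_iff.2 fun B hB => ?_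
  rw [Measure.map_apply hT hB, Measure.restrict_apply (hT hB), Measure.smul_apply, smul_eq_mul,
    Measure.restrict_apply hB]
  set P : ℕ → Set E := fun l => A ∩ idx ⁻¹' {l} with hP
  have hPm : ∀ l, MeasurableSet (P l) := fun l => hA.inter (hidx (measurableSet_singleton l))
  set R : ℕ → Set E := fun l => {q' | q' - v l ∈ P l} with hR
  have hsubm : ∀ l, Measurable fun q' : E => q' - v l := fun l => by
    simpa [sub_eq_add_neg] using (measurable_id.add_const (-(v l)) : Measurable fun q' : E => _)
  have hRm : ∀ l, MeasurableSet (R l) := fun l => hsubm l (hPm l)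
  have h1 : (fun q => q + v (idx q)) ⁻¹' B ∩ A ⊆
      ⋃ l, (fun q => q + v l) ⁻¹' (R l ∩ B) := by
    rintro q ⟨hq, hqA⟩
    refine Set.mem_iUnion.2 ⟨idx q, ?_, hq⟩
    simp [hR, hP, hqA]
  calc μ ((fun q => q + v (idx q)) ⁻¹' B ∩ A)
      ≤ ∑' l, μ ((fun q => q + v l) ⁻¹' (R l ∩ B)) := (measure_mono h1).trans (measure_iUnion_le _)
    _ = ∑' l, μ (R l ∩ B) := by
        congr 1
        ext l
        exact measure_preimage_add_right μ (v l) _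
    _ = ∑' l, ∫⁻ q', (R l ∩ B).indicator 1 q' ∂μ := by
        congr 1
        ext l
        rw [lintegral_indicator_one ((hRm l).inter hB)]
    _ = ∫⁻ q', ∑' l, (R l ∩ B).indicator 1 q' ∂μ :=
        (lintegral_tsum fun l =>
          (measurable_one.indicator ((hRm l).inter hB)).aemeasurable).symm
    _ ≤ ∫⁻ q', (B ∩ A').indicator (fun _ => (N : ℝ≥0∞)) q' ∂μ := by
        refine lintegral_mono fun q' => ?_
        obtain ⟨s, hs, hs'⟩ := hN q'
        have hmem : ∀ l, q' ∈ R l ∩ B → l ∈ s ∧ q' ∈ B ∩ A' := by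
          rintro l ⟨⟨h2, h3⟩, h4⟩
          have h3 : idx (q' - v l) = l := h3
          have h5 : q' - v l + v (idx (q' - v l)) = q' := by rw [h3]; abel
          have h6 := hs' _ h2 h5
          have h7 := hAA _ h2
          rw [h5] at h7
          rw [h3] at h6
          exact ⟨h6, h4, h7⟩
        by_cases hq' : q' ∈ B ∩ A'
        · rw [Set.indicator_of_mem hq', tsum_eq_sum (s := s)]
          · calc ∑ l ∈ s, (R l ∩ B).indicator (1 : E → ℝ≥0∞) q' ≤ ∑ l ∈ s, 1 :=
                  Finset.sum_le_sum fun l _ => Set.indicator_le_self _ _ _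
              _ ≤ N := by simpa using hs
          · intro l hl
            exact Set.indicator_of_notMem (fun h => hl (hmem l h).1) _
        · have : ∀ l, (R l ∩ B).indicator (1 : E → ℝ≥0∞) q' = 0 := fun l =>
            Set.indicator_of_notMem (fun h => hq' (hmem l h).2) _
          simp [this]
    _ = N * μ (B ∩ A') := lintegral_indicator_const (hB.inter hA') _

end Norms

section Algebra

open MvPolynomial

theorem totalDegree_pderiv_le {σ : Type*} (i : σ) (p : MvPolynomial σ ℝ) :
    (pderiv i p).totalDegree ≤ p.totalDegree := by
  refine Finset.sup_le fun m hm => ?_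
  rw [mem_support_iff, coeff_pderiv] at hm
  have h := le_totalDegree (mem_support_iff.2 (left_ne_zero_of_mul hm))
  refine le_trans ?_ h
  rw [Finsupp.sum_add_index' (by simp) (by simp)]
  exact Nat.le_add_right _ _

theorem pderiv_pderiv_comm {σ : Type*} (i j : σ) (p : MvPolynomial σ ℝ) :
    pderiv i (pderiv j p) = pderiv j (pderiv i p) := by
  classical
  by_cases hij : i = j
  · rw [hij]
  ext m
  simp only [coeff_pderiv, Finsupp.add_apply, Finsupp.single_apply, hij, Ne.symm hij, if_false]
  rw [add_right_comm m]
  push_cast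
  ring

theorem derivative_aeval {σ : Type*} [Fintype σ] (f : σ → Polynomial ℝ) (F : MvPolynomial σ ℝ) :
    (aeval f F).derivative = ∑ k, aeval f (pderiv k F) * (f k).derivative := by
  classical
  induction F using MvPolynomial.induction_on with
  | C a => simp
  | add p q hp hq => simp [hp, hq, add_mul, Finset.sum_add_distrib]
  | mul_X p i hp =>
    simp only [map_mul, aeval_X, Polynomial.derivative_mul, hp, Derivation.leibniz, pderiv_X,
      smul_eq_mul, map_add, add_mul, Finset.sum_add_distrib]
    rw [add_comm]
    congr 1
    · rw [Finset.sum_eq_single i]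
      · simp
      · intro b _ hb
        simp [Ne.symm hb]
      · simp
    · rw [Finset.sum_mul]
      exact Finset.sum_congr rfl fun k _ => by ring

theorem eval_aeval_polynomial {σ : Type*} (f : σ → Polynomial ℝ) (F : MvPolynomial σ ℝ) (t : ℝ) :
    (aeval f F).eval t = eval (fun k => (f k).eval t) F := by
  induction F using MvPolynomial.induction_on with
  | C a => simp
  | add p q hp hq => simp [hp, hq]
  | mul_X p i hp => simp [hp]

variable {d : ℕ}

/-- Derivative along `e_j + c_j e_{d+1}`. -/
def tanDir (c : Fin d → ℝ) (j : Fin d) : Module.End ℝ (MvPolynomial (Fin (d + 1)) ℝ) :=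
  (pderiv (Fin.castSucc j)).toLinearMap + c j • (pderiv (Fin.last d)).toLinearMap

theorem tanDir_apply (c : Fin d → ℝ) (j : Fin d) (P : MvPolynomial (Fin (d + 1)) ℝ) :
    tanDir c j P = pderiv (Fin.castSucc j) P + c j • pderiv (Fin.last d) P := rfl

/-- Iterated derivative along the directions `e_j + c_j e_{d+1}` for `j` in a list. -/
def tanList (c : Fin d → ℝ) (l : List (Fin d)) : Module.End ℝ (MvPolynomial (Fin (d + 1)) ℝ) :=
  (l.map (tanDir c)).prod

theorem tanList_nil (c : Fin d → ℝ) (P : MvPolynomial (Fin (d + 1)) ℝ) :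
    tanList c [] P = P := rfl

theorem tanList_cons (c : Fin d → ℝ) (j : Fin d) (l : List (Fin d))
    (P : MvPolynomial (Fin (d + 1)) ℝ) :
    tanList c (j :: l) P = tanDir c j (tanList c l P) := by
  simp [tanList]

theorem exists_tanList_eq_tanOpD (α : Fin d → ℕ) :
    ∃ l : List (Fin d), l.length = ∑ k, α k ∧ ∀ c P, tanOpD c α P = tanList c l P := by
  have key : ∀ L : List (Fin d), ∃ l : List (Fin d), l.length = (L.map α).sum ∧
      ∀ (c : Fin d → ℝ) (P : MvPolynomial (Fin (d + 1)) ℝ), L.foldl (fun Q j =>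
        (fun Q' => pderiv (Fin.castSucc j) Q' + c j • pderiv (Fin.last d) Q')^[α j] Q) P =
          tanList c l P := by
    intro L
    induction L with
    | nil => exact ⟨[], by simp, fun c P => rfl⟩
    | cons j L ih =>
      obtain ⟨l, hl, h⟩ := ih
      refine ⟨l ++ List.replicate (α j) j, by simp [hl, add_comm], fun c P => ?_⟩
      rw [List.foldl_cons, h]
      have e : (fun Q' => pderiv (Fin.castSucc j) Q' + c j • pderiv (Fin.last d) Q') =
        ⇑(tanDir c j) := rfl
      rw [e, tanList, tanList, List.map_append, List.prod_append, List.map_replicate,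
        List.prod_replicate, Module.End.mul_apply, Module.End.pow_apply]
  obtain ⟨l, hl, h⟩ := key (List.finRange d)
  refine ⟨l, ?_, fun c P => h c P⟩
  rw [hl, ← List.ofFn_eq_map, List.sum_ofFn]

theorem pderiv_last_tanDir (c : Fin d → ℝ) (j : Fin d) (P : MvPolynomial (Fin (d + 1)) ℝ) :
    pderiv (Fin.last d) (tanDir c j P) = tanDir c j (pderiv (Fin.last d) P) := by
  simp only [tanDir_apply, map_add, Derivation.map_smul]
  rw [pderiv_pderiv_comm]

theorem pderiv_last_tanList (c : Fin d → ℝ) (l : List (Fin d)) (P : MvPolynomial (Fin (d + 1)) ℝ) :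
    pderiv (Fin.last d) (tanList c l P) = tanList c l (pderiv (Fin.last d) P) := by
  induction l with
  | nil => rfl
  | cons j l ih => rw [tanList_cons, tanList_cons, pderiv_last_tanDir, ih]

theorem totalDegree_tanList_le (c : Fin d → ℝ) (l : List (Fin d))
    (P : MvPolynomial (Fin (d + 1)) ℝ) : (tanList c l P).totalDegree ≤ P.totalDegree := by
  induction l with
  | nil => rfl
  | cons j l ih =>
    rw [tanList_cons, tanDir_apply]
    refine (totalDegree_add _ _).trans (max_le ((totalDegree_pderiv_le _ _).trans ih) ?_)
    exact (totalDegree_smul_le _ _).trans ((totalDegree_pderiv_le _ _).trans ih)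

theorem totalDegree_iterate_pderiv_le {σ : Type*} (i : σ) (k : ℕ) (P : MvPolynomial σ ℝ) :
    ((pderiv i)^[k] P).totalDegree ≤ P.totalDegree := by
  induction k with
  | zero => rfl
  | succ k ih =>
    rw [Function.iterate_succ_apply']
    exact (totalDegree_pderiv_le _ _).trans ih

/-- Changing the slopes from `c` to `c'`, with `|c i - c' i| ≤ η`, expands an iterated tangential
derivative into mixed tangential and vertical derivatives. -/
theorem abs_tanList_le_sum_sublists {c c' : Fin d → ℝ} {η : ℝ} (hη : 0 ≤ η)
    (hc : ∀ i, |c i - c' i| ≤ η)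
    (l : List (Fin d)) (Λ : MvPolynomial (Fin (d + 1)) ℝ →ₗ[ℝ] ℝ)
    (P : MvPolynomial (Fin (d + 1)) ℝ) :
    |Λ (tanList c l P)| ≤ (l.sublists'.map fun l' => η ^ (l.length - l'.length) *
      |Λ (tanList c' l' ((pderiv (Fin.last d))^[l.length - l'.length] P))|).sum := by
  induction l generalizing Λ P with
  | nil => simp [tanList_nil]
  | cons j l ih =>
    have e : Λ (tanList c (j :: l) P) = (Λ ∘ₗ tanDir c' j) (tanList c l P) +
        (c j - c' j) * Λ (tanList c l (pderiv (Fin.last d) P)) := by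
      rw [tanList_cons, tanDir_apply, LinearMap.comp_apply, tanDir_apply, ← pderiv_last_tanList]
      simp only [map_add, map_smul, smul_eq_mul]
      ring
    rw [e, List.sublists'_cons, List.map_append, List.sum_append, List.map_map, add_comm]
    refine (abs_add_le _ _).trans (add_le_add ?_ ?_)
    · rw [abs_mul]
      calc |c j - c' j| * |Λ (tanList c l (pderiv (Fin.last d) P))|
          ≤ η * (l.sublists'.map fun l' => η ^ (l.length - l'.length) *
              |Λ (tanList c' l' ((pderiv (Fin.last d))^[l.length - l'.length]
                (pderiv (Fin.last d) P)))|).sum := by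
            gcongr
            · exact hc j
            · exact ih Λ _
        _ = _ := by
            rw [← List.sum_map_mul_left]
            congr 1
            refine List.map_congr_left fun l' hl' => ?_
            have hle : l'.length ≤ l.length := (List.mem_sublists'.1 hl').length_le
            rw [List.length_cons, Nat.succ_sub hle, pow_succ', Function.iterate_succ_apply,
              mul_assoc]
    · refine (ih (Λ ∘ₗ tanDir c' j) P).trans (le_of_eq ?_)
      congr 1
      refine List.map_congr_left fun l' _ => ?_
      simp [tanList_cons]

end Algebra

section Shear

variable {d : ℕ}

theorem xpart_apply (q : EuclideanSpace ℝ (Fin (d + 1))) (i : Fin d) :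
    xpart q i = q i.castSucc := rfl

theorem measurable_xpart : Measurable (xpart : EuclideanSpace ℝ (Fin (d + 1)) → _) := by
  have : Continuous (xpart : EuclideanSpace ℝ (Fin (d + 1)) → _) := by
    unfold xpart
    fun_prop
  exact this.measurable

theorem measurable_ypart : Measurable (ypart : EuclideanSpace ℝ (Fin (d + 1)) → ℝ) := by
  have : Continuous (ypart : EuclideanSpace ℝ (Fin (d + 1)) → _) := by
    unfold ypart
    fun_prop
  exact this.measurable

/-- Translation by `v` followed by a vertical displacement depending on the base point. -/
def shear (v : EuclideanSpace ℝ (Fin (d + 1))) (w : EuclideanSpace ℝ (Fin d) → ℝ)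
    (q : EuclideanSpace ℝ (Fin (d + 1))) : EuclideanSpace ℝ (Fin (d + 1)) :=
  q + w (xpart q) • EuclideanSpace.single (Fin.last d) 1 + v

theorem measurePreserving_shear (v : EuclideanSpace ℝ (Fin (d + 1)))
    {w : EuclideanSpace ℝ (Fin d) → ℝ} (hw : Measurable w) :
    MeasurePreserving (shear v w) volume volume := by
  have h1 : MeasurePreserving (fun q : EuclideanSpace ℝ (Fin (d + 1)) =>
      q + w (xpart q) • EuclideanSpace.single (Fin.last d) 1) volume volume := by
    have e1 := PiLp.volume_preserving_ofLp (Fin (d + 1))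
    have e2 := volume_preserving_piFinSuccAbove (fun _ : Fin (d + 1) => ℝ) (Fin.last d)
    have e3 : MeasurePreserving (Prod.swap : ℝ × (Fin d → ℝ) → _) volume volume :=
      Measure.measurePreserving_swap
    have e3' : MeasurePreserving (Prod.swap : (Fin d → ℝ) × ℝ → _) volume volume :=
      Measure.measurePreserving_swap
    have hw' : Measurable fun x : Fin d → ℝ => w (WithLp.toLp 2 x) :=
      hw.comp (WithLp.measurable_toLp 2 _)
    have e4 : MeasurePreserving (fun z : (Fin d → ℝ) × ℝ => (z.1, z.2 + w (WithLp.toLp 2 z.1)))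
        volume volume := by
      refine MeasurePreserving.skew_product (MeasurePreserving.id volume)
        (g := fun x y => y + w (WithLp.toLp 2 x)) ?_ ?_
      · exact measurable_snd.add (hw'.comp measurable_fst)
      · exact Filter.Eventually.of_forall fun x => (measurePreserving_add_right volume _).map_eq
    have e5 := (PiLp.volume_preserving_toLp (Fin (d + 1))).comp
      ((e2.symm _).comp (e3'.comp (e4.comp (e3.comp (e2.comp e1)))))
    refine (congrArg (MeasurePreserving · volume volume) ?_).mpr e5
    funext q
    refine PiLp.ext fun k => ?_
    refine Fin.lastCases ?_ (fun i => ?_) k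
    · simp [MeasurableEquiv.piFinSuccAbove]
      rfl
    · simp [MeasurableEquiv.piFinSuccAbove, Fin.init]
  exact (measurePreserving_add_right volume v).comp h1

end Shear

section Norms

variable {X : Type*} [MeasurableSpace X] {μ : Measure X}

theorem eLpNorm_le_of_pointwise_scaled {p : ℝ≥0∞} (hp : p ≠ 0) {A A' : Set X}
    (hA : MeasurableSet A)
    {ι : Type*} [Fintype ι] {T : ι → X → X} {b D : ι → ℝ} {N : ι → ℕ} {F : X → ℝ}
    {G : ι → X → ℝ} (hG : ∀ k, Measurable (G k)) (hT : ∀ k, Measurable (T k))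
    (hN1 : ∀ k, 1 ≤ N k)
    (hN : ∀ k, Measure.map (T k) (μ.restrict A) ≤ (N k : ℝ≥0∞) • μ.restrict A')
    (hb : ∀ k, 0 ≤ b k) (hD : ∀ k, 0 ≤ D k) {κ : ℝ} (hκ : 0 ≤ κ)
    (hF : ∀ q ∈ A, |F q| ≤ κ * ∑ k, b k * |G k (T k q)|) {Y : ℝ≥0∞} {C : ℝ}
    (hY : ∀ k, eLpNorm (G k) p (μ.restrict A') ≤ ENNReal.ofReal (D k) * Y)
    (hC : ∑ k, (b k * D k) ^ subaddExp p * N k ≤ C) :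
    eLpNorm F p (μ.restrict A) ≤ ENNReal.ofReal (C ^ (1 / subaddExp p) * κ) * Y := by
  have hC0 : 0 ≤ C := le_trans (Finset.sum_nonneg fun k _ => by
    have := hb k; have := hD k; positivity) hC
  have hq := subaddExp_pos hp
  have h := eLpNorm_le_of_pointwise (μ := μ) (b := fun k => κ * b k)
    (C := κ ^ subaddExp p * C) hp hA hG hT hN1 hN
    (fun k => mul_nonneg hκ (hb k)) hD (F := F)
    (fun q hq => by
      refine (hF q hq).trans (le_of_eq ?_)
      rw [Finset.mul_sum]
      exact Finset.sum_congr rfl fun k _ => by ring) hY (by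
      refine le_trans (le_of_eq ?_) (mul_le_mul_of_nonneg_left hC
        (Real.rpow_nonneg hκ (subaddExp p)))
      rw [Finset.mul_sum]
      refine Finset.sum_congr rfl fun k _ => ?_
      rw [mul_assoc κ, Real.mul_rpow hκ (mul_nonneg (hb k) (hD k)), mul_assoc])
  rwa [Real.mul_rpow (Real.rpow_nonneg hκ _) hC0, ← Real.rpow_mul hκ,
    mul_one_div_cancel hq.ne', Real.rpow_one, mul_comm κ] at h

end Norms

section Vertical

variable {d : ℕ}

/-- The points of depth in `[0,t)` below the graph of `γ` over the open cube `(-t,t)^d`. -/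
def graphDomain (γ : EuclideanSpace ℝ (Fin d) → ℝ) (t : ℝ) : Set (EuclideanSpace ℝ (Fin (d + 1))) :=
  {q | (∀ k, xpart q k ∈ Set.Ioo (-t) t) ∧ γ (xpart q) - t < ypart q ∧ ypart q ≤ γ (xpart q)}

theorem measurableSet_graphDomain {γ : EuclideanSpace ℝ (Fin d) → ℝ} (hγ : Measurable γ) (t : ℝ) :
    MeasurableSet (graphDomain γ t) := by
  have hγ' := hγ.comp (measurable_xpart (d := d))
  have hx : MeasurableSet {q : EuclideanSpace ℝ (Fin (d + 1)) |
      ∀ k, xpart q k ∈ Set.Ioo (-t) t} := by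
    rw [Set.ofPred_forall]
    refine MeasurableSet.iInter fun k => ?_
    have : Measurable fun q : EuclideanSpace ℝ (Fin (d + 1)) => xpart q k := by
      simp only [xpart_apply]
      fun_prop
    exact this measurableSet_Ioo
  exact hx.inter ((measurableSet_lt (hγ'.sub_const t) measurable_ypart).inter
    (measurableSet_le measurable_ypart hγ'))

/-- The vertical distance to the graph of `γ`. -/
def depth (γ : EuclideanSpace ℝ (Fin d) → ℝ) (q : EuclideanSpace ℝ (Fin (d + 1))) : ℝ :=
  γ (xpart q) - ypart q

theorem measurable_depth {γ : EuclideanSpace ℝ (Fin d) → ℝ} (hγ : Measurable γ) :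
    Measurable (depth γ) :=
  (hγ.comp measurable_xpart).sub measurable_ypart

theorem mem_graphDomain {γ : EuclideanSpace ℝ (Fin d) → ℝ} {t : ℝ}
    {q : EuclideanSpace ℝ (Fin (d + 1))} :
    q ∈ graphDomain γ t ↔ (∀ k, xpart q k ∈ Set.Ioo (-t) t) ∧ depth γ q < t ∧ 0 ≤ depth γ q := by
  simp only [graphDomain, depth, Set.mem_ofPred_eq, sub_nonneg]
  rw [sub_lt_comm]

/-- The weight `√(γ(x) - y) + 1/n`. -/
def weight (γ : EuclideanSpace ℝ (Fin d) → ℝ) (n : ℕ) (q : EuclideanSpace ℝ (Fin (d + 1))) : ℝ :=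
  √(depth γ q) + 1 / n

theorem weight_nonneg (γ : EuclideanSpace ℝ (Fin d) → ℝ) (n : ℕ)
    (q : EuclideanSpace ℝ (Fin (d + 1))) : 0 ≤ weight γ n q := by
  unfold weight
  positivity

theorem measurable_weight {γ : EuclideanSpace ℝ (Fin d) → ℝ} (hγ : Measurable γ) (n : ℕ) :
    Measurable (weight γ n) :=
  (measurable_depth hγ).sqrt.add_const _

/-- The last standard basis vector. -/
abbrev lastVec (d : ℕ) : EuclideanSpace ℝ (Fin (d + 1)) := EuclideanSpace.single (Fin.last d) 1

@[simp] theorem xpart_add_smul_lastVec (q : EuclideanSpace ℝ (Fin (d + 1))) (s : ℝ) :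
    xpart (q + s • lastVec d) = xpart q := by
  ext k
  simp [xpart_apply]

@[simp] theorem ypart_add_smul_lastVec (q : EuclideanSpace ℝ (Fin (d + 1))) (s : ℝ) :
    ypart (q + s • lastVec d) = ypart q + s := by
  simp [ypart]

@[simp] theorem depth_add_smul_lastVec (γ : EuclideanSpace ℝ (Fin d) → ℝ)
    (q : EuclideanSpace ℝ (Fin (d + 1))) (s : ℝ) :
    depth γ (q + s • lastVec d) = depth γ q - s := by
  simp [depth]
  ring

/-- `H₁` is the vertical derivative of `H`, which is a polynomial of degree at most `n` on vertical
lines. -/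
structure HasVerticalDeriv (n : ℕ) (H H₁ : EuclideanSpace ℝ (Fin (d + 1)) → ℝ) : Prop where
  measurable : Measurable H
  measurable_deriv : Measurable H₁
  exists_polynomial : ∀ q, ∃ R : Polynomial ℝ, R.natDegree ≤ n ∧
    (∀ t : ℝ, R.eval t = H (q + t • lastVec d)) ∧ R.derivative.eval 0 = H₁ q

/-- Markov-type inequality in the vertical direction. -/
theorem exists_vertical_markov {p : ℝ≥0∞} (hp : p ≠ 0) {r s : ℝ} (hrs : r < s) (i : ℕ) :
    ∃ C : ℝ, 0 ≤ C ∧ ∀ a : ℝ, 1 ≤ a → ∀ γ : EuclideanSpace ℝ (Fin d) → ℝ, Measurable γ →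
      ∀ n : ℕ, 0 < n → ∀ H H₁, HasVerticalDeriv n H H₁ →
        eLpNorm (fun q => weight γ n q ^ i * H₁ q) p (volume.restrict (graphDomain γ (r * a))) ≤
          ENNReal.ofReal (C * n ^ 2) *
            eLpNorm (fun q => weight γ n q ^ i * H q) p
              (volume.restrict (graphDomain γ (s * a))) := by
  set δ := √(s - r) / 2 with hδ
  have hδ0 : 0 < δ := by
    have := Real.sqrt_pos.2 (sub_pos.2 hrs)
    positivity
  have hδ2 : (2 * δ) ^ 2 = s - r := by
    rw [hδ, mul_div_cancel₀ _ two_ne_zero, Real.sq_sqrt (sub_pos.2 hrs).le]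
  have hq := subaddExp_pos hp
  obtain ⟨C, hC0, hC⟩ := exists_derivative_nodes hδ0 hq 0
  refine ⟨(C * C) ^ (1 / subaddExp p), by positivity, ?_⟩
  intro a ha γ hγ n hn H H₁ hH
  obtain ⟨K, u, b, hu, hb, hsum, hQ⟩ := hC n hn
  simp only [pow_zero, mul_one] at hsum
  have hA := measurableSet_graphDomain hγ (r * a)
  have hA' := measurableSet_graphDomain hγ (s * a)
  have hshift : ∀ k l, (u k + u l) ^ 2 ≤ s - r := fun k l => by
    rw [← hδ2]
    refine sq_le_sq' ?_ ?_ <;> have h1 := abs_le.1 (hu k) <;> have h2 := abs_le.1 (hu l) <;>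
      linarith
  refine eLpNorm_le_of_pointwise_scaled (ι := Fin K × Fin K) (N := fun _ => 1)
    (A' := graphDomain γ (s * a))
    (T := fun k q => q + (-(u k.1 + u k.2) ^ 2) • lastVec d) (b := fun k => b k.1 * b k.2)
    (D := fun _ => 1) (G := fun _ q => weight γ n q ^ i * H q) hp hA
    (fun _ => ((measurable_weight hγ n).pow_const i).mul hH.measurable)
    (fun k => measurable_id.add_const _) (fun _ => le_rfl) ?_
    (fun k => mul_nonneg (hb _) (hb _)) (fun _ => zero_le_one) (by positivity) ?_
    (fun k => by simp) ?_
  · intro k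
    refine map_restrict_le_of_measurePreserving hA' (measurePreserving_add_right volume _) ?_
    intro q hq
    rw [mem_graphDomain] at hq ⊢
    have hle : r * a ≤ s * a := by nlinarith
    refine ⟨fun j => ?_, ?_, ?_⟩
    · rw [xpart_add_smul_lastVec]
      exact Set.Ioo_subset_Ioo (neg_le_neg hle) hle (hq.1 j)
    · rw [depth_add_smul_lastVec]
      nlinarith [hshift k.1 k.2]
    · rw [depth_add_smul_lastVec]
      nlinarith [hq.2.2, sq_nonneg (u k.1 + u k.2)]
  · intro q hq
    obtain ⟨R, hR, hRH, hR1⟩ := hH.exists_polynomial q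
    set Q : Polynomial ℝ := R.comp (-Polynomial.X ^ 2) with hQdef
    have hQdeg : Q.natDegree ≤ 2 * n := by
      refine Polynomial.natDegree_comp_le.trans ?_
      rw [Polynomial.natDegree_neg, Polynomial.natDegree_X_pow, mul_comm]
      omega
    have hQ2 : |H₁ q| ≤ |Q.derivative.derivative.eval 0| := by
      have : Q.derivative.derivative.eval 0 = -2 * H₁ q := by
        rw [← hR1, hQdef]
        norm_num [Polynomial.derivative_comp]
      rw [this, abs_mul]
      norm_num
      linarith [abs_nonneg (H₁ q)]
    have h1 : ∀ k, |Q.derivative.eval (u k)| ≤ n * ∑ l, b l * |Q.eval (u k + u l)| := by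
      intro k
      have := hQ (Q.comp (Polynomial.X + Polynomial.C (u k))) (by
        refine Polynomial.natDegree_comp_le.trans ?_
        simpa using hQdeg)
      simpa [Polynomial.derivative_comp, add_comm] using this
    have h2 : |H₁ q| ≤ n ^ 2 * ∑ k, ∑ l, b k * b l * |Q.eval (u k + u l)| := by
      calc |H₁ q| ≤ n * ∑ k, b k * |Q.derivative.eval (u k)| :=
            hQ2.trans (hQ _ ((Polynomial.natDegree_derivative_le _).trans (by omega)))
        _ ≤ n * ∑ k, b k * (n * ∑ l, b l * |Q.eval (u k + u l)|) := by
            gcongr with k _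
            · exact hb k
            · exact h1 k
        _ = _ := by
            simp only [Finset.mul_sum]
            refine Finset.sum_congr rfl fun k _ => Finset.sum_congr rfl fun l _ => by ring
    have hev : ∀ t, Q.eval t = H (q + (-t ^ 2) • lastVec d) := fun t => by
      rw [hQdef, Polynomial.eval_comp, hRH]
      simp
    rw [abs_mul, abs_of_nonneg (pow_nonneg (weight_nonneg γ n q) i), Fintype.sum_prod_type]
    calc weight γ n q ^ i * |H₁ q|
        ≤ weight γ n q ^ i * (n ^ 2 * ∑ k, ∑ l, b k * b l * |Q.eval (u k + u l)|) :=
          mul_le_mul_of_nonneg_left h2 (pow_nonneg (weight_nonneg γ n q) i)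
      _ = n ^ 2 * ∑ k, ∑ l, b k * b l * (weight γ n q ^ i * |Q.eval (u k + u l)|) := by
          simp only [Finset.mul_sum]
          refine Finset.sum_congr rfl fun k _ => Finset.sum_congr rfl fun l _ => by ring
      _ ≤ _ := by
          gcongr with k _ l _
          · exact mul_nonneg (hb k) (hb l)
          · rw [hev, abs_mul, abs_of_nonneg (pow_nonneg (weight_nonneg γ n _) i)]
            refine mul_le_mul_of_nonneg_right (pow_le_pow_left₀ (weight_nonneg γ n q) ?_ i)
              (abs_nonneg _)
            unfold weight
            rw [depth_add_smul_lastVec]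
            gcongr
            nlinarith [sq_nonneg (u k + u l)]
  · simp only [mul_one, Nat.cast_one, Fintype.sum_prod_type]
    calc ∑ k, ∑ l, (b k * b l) ^ subaddExp p
        = (∑ k, b k ^ subaddExp p) * ∑ l, b l ^ subaddExp p := by
          rw [Finset.sum_mul_sum]
          refine Finset.sum_congr rfl fun k _ => Finset.sum_congr rfl fun l _ =>
            Real.mul_rpow (hb k) (hb l)
      _ ≤ C * C := by
          gcongr
          exact Finset.sum_nonneg fun k _ => Real.rpow_nonneg (hb k) _

end Vertical

/-- The sequence `0, 1, 2, 4, 8, …`. -/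
def dyadic (l : ℕ) : ℕ := 2 ^ l / 2

theorem dyadic_succ (l : ℕ) : dyadic (l + 1) = 2 ^ l := by
  rw [dyadic, pow_succ, Nat.mul_div_cancel _ two_pos]

theorem le_dyadic (l : ℕ) : l ≤ dyadic l := by
  cases l with
  | zero => exact Nat.zero_le _
  | succ l => rw [dyadic_succ]; exact Nat.lt_two_pow_self

theorem dyadic_size_le (m : ℕ) : dyadic m.size ≤ m := by
  rcases h : m.size with _ | l
  · exact Nat.zero_le _
  · rw [dyadic_succ]
    exact Nat.lt_size.1 (by omega)

theorem lt_two_mul_dyadic_size (m : ℕ) : m < 2 * dyadic m.size + 1 := by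
  have h := Nat.lt_size_self m
  rcases h' : m.size with _ | l
  · rw [h'] at h
    omega
  · rw [h', pow_succ] at h
    rw [dyadic_succ]
    omega

/-- The indices of the dyadic layers which a displacement `s ↦ (s + u/2)² + (τ - s²)` can carry to
a given depth. -/
theorem exists_finset_dyadic (x y : ℝ) :
    ∃ s : Finset ℕ, s.card ≤ ⌈x⌉₊ + 4 ∧ ∀ l : ℕ,
      ((dyadic l : ℝ) < x ∨ l = 0 ∨ (y < 3 * dyadic l ∧ (dyadic l : ℝ) ≤ 2 * y)) → l ∈ s := by
  classical
  have h1 : ∀ l : ℕ, (dyadic l : ℝ) < x ∨ l = 0 → l ∈ Finset.range (⌈x⌉₊ + 1) := by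
    rintro l (hl | rfl)
    · have : (l : ℝ) < (⌈x⌉₊ : ℝ) := by
        have h2 : (l : ℝ) ≤ dyadic l := by exact_mod_cast le_dyadic l
        linarith [Nat.le_ceil x]
      rw [Finset.mem_range]
      have : l < ⌈x⌉₊ := by exact_mod_cast this
      omega
    · simp
  by_cases hex : ∃ l : ℕ, 1 ≤ l ∧ y < 3 * dyadic l
  · set l₀ := Nat.find hex with hl₀
    obtain ⟨h2, h3⟩ := Nat.find_spec hex
    refine ⟨Finset.range (⌈x⌉₊ + 1) ∪ Finset.Icc l₀ (l₀ + 2), ?_, ?_⟩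
    · refine (Finset.card_union_le _ _).trans ?_
      rw [Finset.card_range, Nat.card_Icc]
      omega
    · intro l hl
      rw [Finset.mem_union]
      rcases Nat.eq_zero_or_pos l with h0 | hpos
      · exact Or.inl (h1 l (Or.inr h0))
      rcases hl with hl | hl | ⟨hl, hl'⟩
      · exact Or.inl (h1 l (Or.inl hl))
      · exact Or.inl (h1 l (Or.inr hl))
      · right
        rw [Finset.mem_Icc]
        refine ⟨Nat.find_min' hex ⟨hpos, hl⟩, ?_⟩
        by_contra hcon
        push Not at hcon
        obtain ⟨m, hm⟩ := Nat.exists_eq_add_of_le' h2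
        have h4 : dyadic l₀ = 2 ^ m := by rw [hl₀, hm, dyadic_succ]
        obtain ⟨m', hm'⟩ := Nat.exists_eq_add_of_le' hpos
        have h5 : dyadic l = 2 ^ m' := by rw [hm', dyadic_succ]
        have h6 : 2 ^ (m + 3) ≤ 2 ^ m' := Nat.pow_le_pow_right two_pos (by omega)
        have h7 : (8 * 2 ^ m : ℝ) ≤ 2 ^ m' := by
          have : (2 : ℝ) ^ (m + 3) ≤ 2 ^ m' := by exact_mod_cast h6
          rw [pow_add] at this
          linarith
        rw [← hl₀, h4] at h3
        rw [h5] at hl'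
        push_cast at h3 hl'
        have : (0 : ℝ) < 2 ^ m := by positivity
        linarith
  · refine ⟨Finset.range (⌈x⌉₊ + 1), by simp, ?_⟩
    intro l hl
    rcases Nat.eq_zero_or_pos l with h0 | hpos
    · exact h1 l (Or.inr h0)
    rcases hl with hl | hl | ⟨hl, -⟩
    · exact h1 l (Or.inl hl)
    · exact h1 l (Or.inr hl)
    · exact absurd ⟨l, hpos, hl⟩ hex

section Vertical

variable {d : ℕ}

/-- The dyadic layer of a point. -/
def layer (γ : EuclideanSpace ℝ (Fin d) → ℝ) (n : ℕ) (q : EuclideanSpace ℝ (Fin (d + 1))) : ℕ :=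
  (⌊n * √(depth γ q)⌋₊).size

/-- A lower approximation of `√(depth γ q)`, constant on each layer. -/
def layerRoot (γ : EuclideanSpace ℝ (Fin d) → ℝ) (n : ℕ) (q : EuclideanSpace ℝ (Fin (d + 1))) : ℝ :=
  dyadic (layer γ n q) / n

theorem measurable_layer {γ : EuclideanSpace ℝ (Fin d) → ℝ} (hγ : Measurable γ) (n : ℕ) :
    Measurable (layer γ n) :=
  (measurable_from_nat (f := Nat.size)).comp
    (Nat.measurable_floor.comp ((measurable_depth hγ).sqrt.const_mul _))

theorem measurable_layerRoot {γ : EuclideanSpace ℝ (Fin d) → ℝ} (hγ : Measurable γ) (n : ℕ) :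
    Measurable (layerRoot γ n) :=
  (measurable_from_nat (f := fun l => (dyadic l : ℝ) / n)).comp (measurable_layer hγ n)

theorem layerRoot_nonneg (γ : EuclideanSpace ℝ (Fin d) → ℝ) (n : ℕ)
    (q : EuclideanSpace ℝ (Fin (d + 1))) : 0 ≤ layerRoot γ n q := by
  unfold layerRoot
  positivity

theorem layerRoot_le (γ : EuclideanSpace ℝ (Fin d) → ℝ) {n : ℕ} (hn : 0 < n)
    (q : EuclideanSpace ℝ (Fin (d + 1))) : layerRoot γ n q ≤ √(depth γ q) := by
  have hn' : (0 : ℝ) < n := by exact_mod_cast hn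
  rw [layerRoot, div_le_iff₀ hn', mul_comm]
  refine le_trans ?_ (Nat.floor_le (by positivity))
  exact_mod_cast dyadic_size_le _

theorem mul_sqrt_depth_lt (γ : EuclideanSpace ℝ (Fin d) → ℝ) (n : ℕ)
    (q : EuclideanSpace ℝ (Fin (d + 1))) :
    n * √(depth γ q) < 2 * dyadic (layer γ n q) + 1 ∧
      (layer γ n q ≠ 0 → n * √(depth γ q) < 2 * dyadic (layer γ n q)) := by
  have h0 := Nat.lt_floor_add_one ((n : ℝ) * √(depth γ q))
  set m := ⌊(n : ℝ) * √(depth γ q)⌋₊ with hm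
  have hl : layer γ n q = m.size := rfl
  rw [hl]
  constructor
  · have h1 : m + 1 ≤ 2 * dyadic m.size + 1 := lt_two_mul_dyadic_size m
    have h2 : (m + 1 : ℝ) ≤ 2 * dyadic m.size + 1 := by exact_mod_cast h1
    linarith
  · intro hne
    have h1 : m + 1 ≤ 2 * dyadic m.size := by
      have h := Nat.lt_size_self m
      obtain ⟨l, h'⟩ := Nat.exists_eq_succ_of_ne_zero hne
      rw [h', pow_succ] at h
      rw [h', dyadic_succ]
      omega
    have h2 : (m + 1 : ℝ) ≤ 2 * dyadic m.size := by exact_mod_cast h1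
    linarith

theorem sqrt_depth_le (γ : EuclideanSpace ℝ (Fin d) → ℝ) {n : ℕ} (hn : 0 < n)
    (q : EuclideanSpace ℝ (Fin (d + 1))) : √(depth γ q) ≤ 2 * layerRoot γ n q + 1 / n := by
  have hn' : (0 : ℝ) < n := by exact_mod_cast hn
  have := (mul_sqrt_depth_lt γ n q).1
  rw [layerRoot, ← mul_div_assoc, ← add_div, le_div_iff₀ hn', mul_comm]
  exact this.le

theorem weight_le_mul_weight {γ : EuclideanSpace ℝ (Fin d) → ℝ} {n : ℕ} (hn : 0 < n)
    {q q' : EuclideanSpace ℝ (Fin (d + 1))} {u : ℝ}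
    (h : (layerRoot γ n q + u / 2) ^ 2 ≤ depth γ q') :
    weight γ n q ≤ 2 * (1 + n * |u|) * weight γ n q' := by
  have hn' : (0 : ℝ) < n := by exact_mod_cast hn
  have h1 : |layerRoot γ n q + u / 2| ≤ √(depth γ q') := Real.abs_le_sqrt h
  have h2 := sqrt_depth_le γ hn q
  have h3 := neg_abs_le u
  have h4 := le_abs_self (layerRoot γ n q + u / 2)
  have h5 : 0 ≤ √(depth γ q') := Real.sqrt_nonneg _
  have h6 : (n : ℝ) * |u| * (1 / n) = |u| := by field_simp
  have h7 : 0 ≤ (n : ℝ) * |u| * √(depth γ q') := by positivity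
  unfold weight
  nlinarith [abs_nonneg u]

/-- The layers meeting the preimage of a point under the piecewise displacement. -/
theorem layer_alternatives {γ : EuclideanSpace ℝ (Fin d) → ℝ} {n : ℕ} (hn : 0 < n)
    {q : EuclideanSpace ℝ (Fin (d + 1))} (hq : 0 ≤ depth γ q) {u τ : ℝ}
    (h : depth γ q + (layerRoot γ n q * u + u ^ 2 / 4) = τ) :
    (dyadic (layer γ n q) : ℝ) < n * |u| ∨ layer γ n q = 0 ∨
      (n * √τ < 3 * dyadic (layer γ n q) ∧ (dyadic (layer γ n q) : ℝ) ≤ 2 * (n * √τ)) := by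
  have hn' : (0 : ℝ) < n := by exact_mod_cast hn
  by_cases h1 : (dyadic (layer γ n q) : ℝ) < n * |u|
  · exact Or.inl h1
  by_cases h2 : layer γ n q = 0
  · exact Or.inr (Or.inl h2)
  right; right
  have h3 := (mul_sqrt_depth_lt γ n q).2 h2
  have hσ : (dyadic (layer γ n q) : ℝ) = n * layerRoot γ n q := by
    rw [layerRoot]; field_simp
  rw [hσ] at h1 h3 ⊢
  set σ := layerRoot γ n q with hσd
  have hu : |u| ≤ σ := by
    push Not at h1
    exact le_of_mul_le_mul_left h1 hn'
  have h4 : √(depth γ q) < 2 * σ := by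
    have : n * √(depth γ q) < n * (2 * σ) := by linarith
    exact lt_of_mul_lt_mul_left this hn'.le
  have h5 : σ ≤ √(depth γ q) := layerRoot_le γ hn q
  have hσ0 : 0 < σ := by linarith [Real.sqrt_nonneg (depth γ q)]
  have hsq := Real.sq_sqrt hq
  obtain ⟨hu1, hu2⟩ := abs_le.1 hu
  constructor
  · have : √τ < 3 * σ := by
      rw [Real.sqrt_lt' (by linarith), ← h]
      nlinarith
    nlinarith
  · have : σ / 2 ≤ √τ := by
      refine Real.le_sqrt_of_sq_le ?_
      rw [← h]
      nlinarith
    nlinarith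

/-- The main part of the Bernstein-type inequality in the vertical direction. -/
theorem exists_vertical_bernstein_layerRoot {p : ℝ≥0∞} (hp : p ≠ 0) {r s : ℝ}
    (hr : 0 ≤ r) (hrs : r < s) (hs : s ≤ 2) (i : ℕ) :
    ∃ C : ℝ, 0 ≤ C ∧ ∀ a : ℝ, 1 ≤ a → ∀ γ : EuclideanSpace ℝ (Fin d) → ℝ, Measurable γ →
      ∀ n : ℕ, 0 < n → ∀ H H₁, HasVerticalDeriv n H H₁ →
        eLpNorm (fun q => layerRoot γ n q * (weight γ n q ^ i * H₁ q)) p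
            (volume.restrict (graphDomain γ (r * a))) ≤
          ENNReal.ofReal (C * n) *
            eLpNorm (fun q => weight γ n q ^ i * H q) p
              (volume.restrict (graphDomain γ (s * a))) := by
  set δ := (s - r) / 4 with hδ
  have hδ0 : 0 < δ := by
    have := sub_pos.2 hrs
    positivity
  have hδ1 : δ ≤ 1 := by rw [hδ]; linarith
  have hq := subaddExp_pos hp
  have hq1 := subaddExp_le_one p
  set e := i + ⌈1 / subaddExp p⌉₊ with he
  obtain ⟨C, hC0, hC⟩ := exists_derivative_nodes hδ0 hq e
  refine ⟨(((2 : ℝ) ^ i) ^ subaddExp p * 5 * C) ^ (1 / subaddExp p), by positivity, ?_⟩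
  intro a ha γ hγ n hn H H₁ hH
  have hn' : (0 : ℝ) < n := by exact_mod_cast hn
  obtain ⟨K, u, b, hu, hb, hsum, hQ⟩ := hC n hn
  have hA := measurableSet_graphDomain hγ (r * a)
  have hA' := measurableSet_graphDomain hγ (s * a)
  have hle : r * a ≤ s * a := by nlinarith
  set T : Fin K → EuclideanSpace ℝ (Fin (d + 1)) → EuclideanSpace ℝ (Fin (d + 1)) :=
    fun k q => q + (-(layerRoot γ n q * u k + u k ^ 2 / 4)) • lastVec d with hT
  have hdepth : ∀ k q, depth γ (T k q) = depth γ q + (layerRoot γ n q * u k + u k ^ 2 / 4) :=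
    fun k q => by rw [hT, depth_add_smul_lastVec]; ring
  have hlow : ∀ k q, 0 ≤ depth γ q → (layerRoot γ n q + u k / 2) ^ 2 ≤ depth γ (T k q) := by
    intro k q hq
    rw [hdepth]
    have h1 := layerRoot_le γ hn q
    have h2 := Real.sq_sqrt hq
    have h3 := layerRoot_nonneg γ n q
    nlinarith
  have hAA : ∀ k, ∀ q ∈ graphDomain γ (r * a), T k q ∈ graphDomain γ (s * a) := by
    intro k q hq
    rw [mem_graphDomain] at hq ⊢
    refine ⟨fun j => ?_, ?_, (sq_nonneg _).trans (hlow k q hq.2.2)⟩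
    · rw [hT, xpart_add_smul_lastVec]
      exact Set.Ioo_subset_Ioo (neg_le_neg hle) hle (hq.1 j)
    · rw [hdepth]
      have h1 := layerRoot_le γ hn q
      have h2 : √(depth γ q) ≤ 2 * a := by
        rw [Real.sqrt_le_left (by linarith)]
        nlinarith [hq.2.1]
      have h3 := layerRoot_nonneg γ n q
      have h4 := hu k
      have h5 : layerRoot γ n q * u k ≤ 2 * a * δ :=
        (mul_le_mul_of_nonneg_left (le_abs_self _) h3).trans
          (mul_le_mul (h1.trans h2) h4 (abs_nonneg _) (by linarith))
      have h6 : u k ^ 2 ≤ δ := by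
        rw [← sq_abs]
        nlinarith [abs_nonneg (u k)]
      nlinarith [hq.2.1]
  refine eLpNorm_le_of_pointwise_scaled (ι := Fin K) (N := fun k => ⌈n * |u k|⌉₊ + 4)
    (A' := graphDomain γ (s * a)) (T := T) (b := fun k => (2 * (1 + n * |u k|)) ^ i * b k)
    (D := fun _ => 1) (G := fun _ q => weight γ n q ^ i * H q) hp hA
    (fun _ => ((measurable_weight hγ n).pow_const i).mul hH.measurable)
    (fun k => measurable_id.add
      ((((measurable_layerRoot hγ n).mul_const _).add_const _).neg.smul_const _))
    (fun k => by omega) ?_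
    (fun k => mul_nonneg (by positivity) (hb _)) (fun _ => zero_le_one) hn'.le ?_
    (fun k => by simp) ?_
  · intro k
    refine map_restrict_le_of_piecewise_translation hA hA' (measurable_layer hγ n)
      (fun l => (-((dyadic l / n : ℝ) * u k + u k ^ 2 / 4)) • lastVec d) (hAA k) ?_
    intro q'
    obtain ⟨S, hS, hS'⟩ := exists_finset_dyadic (n * |u k|) (n * √(depth γ q'))
    refine ⟨S, hS, fun q hqA hqq => hS' _ ?_⟩
    refine layer_alternatives hn (mem_graphDomain.1 hqA).2.2 (u := u k) ?_
    rw [← hdepth, ← hqq]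
    rfl
  · intro q hq
    obtain ⟨R, hR, hRH, hR1⟩ := hH.exists_polynomial q
    set σ := layerRoot γ n q with hσ
    set Q : Polynomial ℝ := R.comp (-(Polynomial.C σ * Polynomial.X +
      Polynomial.C (1 / 4) * Polynomial.X ^ 2)) with hQdef
    have hQdeg : Q.natDegree ≤ 2 * n := by
      refine Polynomial.natDegree_comp_le.trans ?_
      rw [mul_comm 2]
      refine Nat.mul_le_mul hR ?_
      rw [Polynomial.natDegree_neg]
      compute_degree
    have hQ1 : σ * |H₁ q| = |Q.derivative.eval 0| := by
      have : Q.derivative.eval 0 = -(σ * H₁ q) := by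
        rw [← hR1, hQdef]
        simp [Polynomial.derivative_comp]
      rw [this, abs_neg, abs_mul, abs_of_nonneg (layerRoot_nonneg γ n q)]
    have hev : ∀ k, Q.eval (u k) = H (T k q) := fun k => by
      rw [hQdef, Polynomial.eval_comp, hRH]
      simp only [hT, ← hσ]
      congr 3
      simp
      ring
    have h0 := mem_graphDomain.1 hq
    have hw := weight_nonneg γ n q
    rw [abs_mul, abs_mul, abs_of_nonneg (layerRoot_nonneg γ n q), abs_of_nonneg (pow_nonneg hw i),
      mul_left_comm, ← hσ, hQ1]
    calc weight γ n q ^ i * |Q.derivative.eval 0|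
        ≤ weight γ n q ^ i * (n * ∑ k, b k * |Q.eval (u k)|) :=
          mul_le_mul_of_nonneg_left (hQ Q hQdeg) (pow_nonneg hw i)
      _ = n * ∑ k, b k * (weight γ n q ^ i * |Q.eval (u k)|) := by
          simp only [Finset.mul_sum]
          refine Finset.sum_congr rfl fun k _ => by ring
      _ ≤ n * ∑ k, b k * ((2 * (1 + n * |u k|) * weight γ n (T k q)) ^ i * |Q.eval (u k)|) := by
          gcongr with k _
          · exact hb k
          · exact weight_le_mul_weight hn (hlow k q h0.2.2)
      _ = _ := by
          congr 1
          refine Finset.sum_congr rfl fun k _ => ?_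
          rw [hev, abs_mul, abs_of_nonneg (pow_nonneg (weight_nonneg γ n _) i), mul_pow]
          ring
  · simp only [mul_one]
    calc ∑ k, ((2 * (1 + n * |u k|)) ^ i * b k) ^ subaddExp p * ((⌈n * |u k|⌉₊ + 4 : ℕ) : ℝ)
        ≤ ∑ k, ((2 : ℝ) ^ i) ^ subaddExp p * 5 * (b k * (1 + n * |u k|) ^ e) ^ subaddExp p := by
          refine Finset.sum_le_sum fun k _ => ?_
          set x := (n : ℝ) * |u k| with hx
          have hx0 : 0 ≤ x := by positivity
          have h1 : ((⌈x⌉₊ + 4 : ℕ) : ℝ) ≤ 5 * (1 + x) := by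
            have := Nat.ceil_lt_add_one hx0
            push_cast
            linarith
          have h2 : 1 + x ≤ ((1 + x) ^ ⌈1 / subaddExp p⌉₊) ^ subaddExp p := by
            rw [← Real.rpow_natCast, ← Real.rpow_mul (by positivity)]
            refine Real.self_le_rpow_of_one_le (by linarith) ?_
            calc (1 : ℝ) = 1 / subaddExp p * subaddExp p := by field_simp
              _ ≤ _ := by gcongr; exact Nat.le_ceil _
          have hbk := hb k
          calc ((2 * (1 + x)) ^ i * b k) ^ subaddExp p * ((⌈x⌉₊ + 4 : ℕ) : ℝ)
              ≤ ((2 * (1 + x)) ^ i * b k) ^ subaddExp p *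
                  (5 * ((1 + x) ^ ⌈1 / subaddExp p⌉₊) ^ subaddExp p) := by
                gcongr
                linarith
            _ = _ := by
                rw [he, pow_add, mul_pow, Real.mul_rpow (by positivity) hbk,
                  Real.mul_rpow (by positivity) (by positivity),
                  Real.mul_rpow hbk (by positivity),
                  Real.mul_rpow (by positivity) (by positivity)]
                ring
      _ ≤ _ := by
          rw [← Finset.mul_sum]
          gcongr

/-- Bernstein-type inequality in the vertical direction. -/
theorem exists_vertical_bernstein {p : ℝ≥0∞} (hp : p ≠ 0) {r s : ℝ}
    (hr : 0 ≤ r) (hrs : r < s) (hs : s ≤ 2) (i : ℕ) :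
    ∃ C : ℝ, 0 ≤ C ∧ ∀ a : ℝ, 1 ≤ a → ∀ γ : EuclideanSpace ℝ (Fin d) → ℝ, Measurable γ →
      ∀ n : ℕ, 0 < n → ∀ H H₁, HasVerticalDeriv n H H₁ →
        eLpNorm (fun q => weight γ n q ^ (i + 1) * H₁ q) p
            (volume.restrict (graphDomain γ (r * a))) ≤
          ENNReal.ofReal (C * n) *
            eLpNorm (fun q => weight γ n q ^ i * H q) p
              (volume.restrict (graphDomain γ (s * a))) := by
  obtain ⟨C₁, hC₁, h₁⟩ := exists_vertical_bernstein_layerRoot (d := d) hp hr hrs hs i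
  obtain ⟨C₂, hC₂, h₂⟩ := exists_vertical_markov (d := d) hp hrs i
  refine ⟨((2 * C₁) ^ subaddExp p + (2 * C₂) ^ subaddExp p) ^ (1 / subaddExp p),
    by positivity, ?_⟩
  intro a ha γ hγ n hn H H₁ hH
  have hn' : (0 : ℝ) < n := by exact_mod_cast hn
  have hA := measurableSet_graphDomain hγ (r * a)
  set Y := eLpNorm (fun q => weight γ n q ^ i * H q) p (volume.restrict (graphDomain γ (s * a)))
    with hY
  have hG : Measurable fun q => weight γ n q ^ i * H₁ q :=
    ((measurable_weight hγ n).pow_const i).mul hH.measurable_deriv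
  have := eLpNorm_le_of_pointwise_scaled (μ := volume) (ι := Fin 2) (N := fun _ => 1)
    (A' := graphDomain γ (r * a)) (T := fun _ => id) (b := ![2, 2 / (n : ℝ)])
    (D := ![C₁, C₂ * n]) (κ := 1) (Y := n * Y)
    (C := (2 * C₁) ^ subaddExp p + (2 * C₂) ^ subaddExp p)
    (F := fun q => weight γ n q ^ (i + 1) * H₁ q)
    (G := ![fun q => layerRoot γ n q * (weight γ n q ^ i * H₁ q),
      fun q => weight γ n q ^ i * H₁ q]) hp hA ?_ (fun _ => measurable_id) (fun _ => le_rfl)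
      ?_ ?_ ?_ zero_le_one ?_ ?_ ?_
  · refine this.trans (le_of_eq ?_)
    rw [mul_one, ENNReal.ofReal_mul (by positivity), ENNReal.ofReal_natCast, mul_assoc]
  · intro k
    fin_cases k
    · exact (measurable_layerRoot hγ n).mul hG
    · exact hG
  · intro k
    exact map_restrict_le_of_measurePreserving hA (MeasurePreserving.id _) fun q hq => hq
  · intro k
    fin_cases k
    · exact zero_le_two
    · exact div_nonneg zero_le_two hn'.le
  · intro k
    fin_cases k
    · exact hC₁
    · exact mul_nonneg hC₂ hn'.le
  · intro q hq
    have h0 : weight γ n q ≤ 2 * layerRoot γ n q + 2 / n := by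
      have := sqrt_depth_le γ hn q
      unfold weight
      have e : (2 : ℝ) / n = 1 / n + 1 / n := by ring
      linarith
    have hw := weight_nonneg γ n q
    have hl := layerRoot_nonneg γ n q
    simp only [Fin.sum_univ_two, Matrix.cons_val_zero, Matrix.cons_val_one, id, one_mul]
    rw [abs_mul, abs_mul, abs_mul, abs_of_nonneg (pow_nonneg hw (i + 1)),
      abs_of_nonneg (pow_nonneg hw i), abs_of_nonneg hl, pow_succ]
    have h1 : 0 ≤ weight γ n q ^ i * |H₁ q| := by positivity
    nlinarith [mul_le_mul_of_nonneg_left h0 h1]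
  · intro k
    fin_cases k
    · refine (h₁ a ha γ hγ n hn H H₁ hH).trans (le_of_eq ?_)
      rw [ENNReal.ofReal_mul hC₁, ENNReal.ofReal_natCast, mul_assoc]
      rfl
    · refine (h₂ a ha γ hγ n hn H H₁ hH).trans (le_of_eq ?_)
      simp only [Fin.mk_one, Matrix.cons_val_one, Matrix.cons_val_zero]
      rw [ENNReal.ofReal_mul hC₂, ENNReal.ofReal_mul hC₂, ENNReal.ofReal_pow hn'.le,
        ENNReal.ofReal_natCast, sq, mul_assoc, mul_assoc, mul_assoc]
  · simp only [Fin.sum_univ_two, Matrix.cons_val_zero, Matrix.cons_val_one, mul_one,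
      Nat.cast_one]
    refine le_of_eq ?_
    congr 2
    field_simp

theorem eLpNorm_le_ofReal_mul_trans {x y z : ℝ≥0∞} {C₁ C₂ : ℝ} (h₁ : 0 ≤ C₁)
    (hx : x ≤ ENNReal.ofReal C₁ * y) (hy : y ≤ ENNReal.ofReal C₂ * z) :
    x ≤ ENNReal.ofReal (C₁ * C₂) * z := by
  refine hx.trans ?_
  rw [ENNReal.ofReal_mul h₁, mul_assoc]
  gcongr

/-- Weighted bounds for iterated vertical derivatives. -/
theorem exists_vertical_bound {p : ℝ≥0∞} (hp : p ≠ 0) (i j : ℕ) {r s : ℝ} (hr : 0 ≤ r) (hrs : r < s)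
    (hs : s ≤ 2) :
    ∃ C : ℝ, 0 ≤ C ∧ ∀ a : ℝ, 1 ≤ a → ∀ γ : EuclideanSpace ℝ (Fin d) → ℝ, Measurable γ →
      ∀ n : ℕ, 0 < n → ∀ H : ℕ → EuclideanSpace ℝ (Fin (d + 1)) → ℝ,
        (∀ k, HasVerticalDeriv n (H k) (H (k + 1))) →
        eLpNorm (fun q => weight γ n q ^ i * H (i + j) q) p
            (volume.restrict (graphDomain γ (r * a))) ≤
          ENNReal.ofReal (C * n ^ (i + 2 * j)) *
            eLpNorm (H 0) p (volume.restrict (graphDomain γ (s * a))) := by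
  induction i generalizing r with
  | zero =>
    induction j generalizing r with
    | zero =>
      refine ⟨1, zero_le_one, fun a ha γ hγ n hn H hH => ?_⟩
      simp only [pow_zero, one_mul, add_zero, mul_zero, ENNReal.ofReal_one]
      refine eLpNorm_mono_measure _ (Measure.restrict_mono ?_ le_rfl)
      intro q hq
      have hle : r * a ≤ s * a := by nlinarith
      rw [mem_graphDomain] at hq ⊢
      exact ⟨fun j => Set.Ioo_subset_Ioo (neg_le_neg hle) hle (hq.1 j), hq.2.1.trans_le hle,
        hq.2.2⟩
    | succ j ih =>
      obtain ⟨m, hm1, hm2⟩ := exists_between hrs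
      obtain ⟨C₁, hC₁, h₁⟩ := exists_vertical_markov (d := d) hp hm1 0
      obtain ⟨C₂, hC₂, h₂⟩ := ih (hr.trans hm1.le) hm2
      refine ⟨C₁ * C₂, by positivity, fun a ha γ hγ n hn H hH => ?_⟩
      have := eLpNorm_le_ofReal_mul_trans (by positivity)
        (h₁ a ha γ hγ n hn _ _ (hH (0 + j))) (h₂ a ha γ hγ n hn H hH)
      refine this.trans (le_of_eq ?_)
      congr 2
      ring
  | succ i ih =>
    obtain ⟨m, hm1, hm2⟩ := exists_between hrs
    obtain ⟨C₁, hC₁, h₁⟩ := exists_vertical_bernstein (d := d) hp hr hm1 (hm2.le.trans hs) i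
    obtain ⟨C₂, hC₂, h₂⟩ := ih (hr.trans hm1.le) hm2
    refine ⟨C₁ * C₂, by positivity, fun a ha γ hγ n hn H hH => ?_⟩
    have := eLpNorm_le_ofReal_mul_trans (by positivity)
      (h₁ a ha γ hγ n hn _ _ (hH (i + j))) (h₂ a ha γ hγ n hn H hH)
    rw [add_right_comm i 1 j]
    refine this.trans (le_of_eq ?_)
    congr 2
    ring

end Vertical

section Tangential

open MvPolynomial

variable {d : ℕ}

theorem tanDir_tanDir_comm (c : Fin d → ℝ) (i j : Fin d) (P : MvPolynomial (Fin (d + 1)) ℝ) :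
    tanDir c i (tanDir c j P) = tanDir c j (tanDir c i P) := by
  simp only [tanDir_apply, map_add, Derivation.map_smul]
  rw [pderiv_pderiv_comm (Fin.castSucc i) (Fin.castSucc j),
    pderiv_pderiv_comm (Fin.castSucc i) (Fin.last d),
    pderiv_pderiv_comm (Fin.castSucc j) (Fin.last d), smul_comm (c i) (c j)]
  abel

theorem tanList_tanDir (c : Fin d → ℝ) (j : Fin d) (l : List (Fin d))
    (P : MvPolynomial (Fin (d + 1)) ℝ) :
    tanDir c j (tanList c l P) = tanList c l (tanDir c j P) := by
  induction l with
  | nil => rfl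
  | cons i l ih => rw [tanList_cons, tanList_cons, tanDir_tanDir_comm, ih]

/-- The tangential derivative of a polynomial, with slopes depending on the base point. -/
def tanFun (c : EuclideanSpace ℝ (Fin d) → Fin d → ℝ) (l : List (Fin d))
    (P : MvPolynomial (Fin (d + 1)) ℝ) (q : EuclideanSpace ℝ (Fin (d + 1))) : ℝ :=
  eval (fun k => q k) (tanList (c (xpart q)) l P)

theorem measurable_tanFun {c : EuclideanSpace ℝ (Fin d) → Fin d → ℝ}
    (hc : ∀ j, Measurable fun x => c x j) (l : List (Fin d)) (P : MvPolynomial (Fin (d + 1)) ℝ) :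
    Measurable (tanFun c l P) := by
  induction l generalizing P with
  | nil =>
    have : Continuous fun q : EuclideanSpace ℝ (Fin (d + 1)) => eval (fun k => q k) P :=
      (continuous_eval P).comp (by fun_prop)
    exact this.measurable
  | cons j l ih =>
    have : tanFun c (j :: l) P = fun q => tanFun c l (pderiv (Fin.castSucc j) P) q +
        c (xpart q) j * tanFun c l (pderiv (Fin.last d) P) q := by
      ext q
      simp only [tanFun]
      rw [tanList_cons, tanList_tanDir, tanDir_apply, map_add, map_add, map_smul, smul_eval]
    rw [this]
    exact (ih _).add (((hc j).comp measurable_xpart).mul (ih _))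

/-- Restriction of a polynomial to a parametrized curve through `q`. -/
theorem exists_polynomial_along_curve (F : MvPolynomial (Fin (d + 1)) ℝ) {n m : ℕ}
    (hF : F.totalDegree ≤ n) (q : EuclideanSpace ℝ (Fin (d + 1)))
    (f : Fin (d + 1) → Polynomial ℝ) (hf : ∀ k, (f k).natDegree ≤ m)
    (hq : ∀ k, (f k).eval 0 = q k) :
    ∃ R : Polynomial ℝ, R.natDegree ≤ m * n ∧
      (∀ t : ℝ, R.eval t = eval (fun k => (f k).eval t) F) ∧
      R.derivative.eval 0 = ∑ k, eval (fun k => q k) (pderiv k F) * (f k).derivative.eval 0 := by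
  refine ⟨aeval f F, ?_, fun t => eval_aeval_polynomial f F t, ?_⟩
  · rw [mul_comm]
    exact (MvPolynomial.aeval_natDegree_le F hF f hf)
  · rw [derivative_aeval, Polynomial.eval_finsetSum]
    refine Finset.sum_congr rfl fun k _ => ?_
    rw [Polynomial.eval_mul, eval_aeval_polynomial]
    simp only [hq]

theorem hasVerticalDeriv_tanFun {c : EuclideanSpace ℝ (Fin d) → Fin d → ℝ}
    (hc : ∀ j, Measurable fun x => c x j) (l : List (Fin d)) {P : MvPolynomial (Fin (d + 1)) ℝ}
    {n : ℕ} (hP : P.totalDegree ≤ n) :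
    HasVerticalDeriv n (tanFun c l P) (tanFun c l (pderiv (Fin.last d) P)) := by
  refine ⟨measurable_tanFun hc l P, measurable_tanFun hc l _, fun q => ?_⟩
  obtain ⟨v, hv⟩ : ∃ v, v = lastVec d := ⟨_, rfl⟩
  obtain ⟨R, h1, h2, h3⟩ := exists_polynomial_along_curve (tanList (c (xpart q)) l P)
    ((totalDegree_tanList_le _ _ _).trans hP) q (m := 1)
    (fun k => Polynomial.C (q k) + Polynomial.C (v k) * Polynomial.X)
    (fun k => by compute_degree) (fun k => by simp)
  refine ⟨R, by simpa using h1, fun t => ?_, ?_⟩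
  · rw [h2, tanFun, xpart_add_smul_lastVec, ← hv]
    congr 2
    ext k
    simp
    ring
  · rw [h3, tanFun, ← pderiv_last_tanList]
    have e : ∀ k, (Polynomial.C (q k) + Polynomial.C (v k) * Polynomial.X).derivative.eval 0 =
        v k := fun k => by simp
    simp only [e]
    rw [Finset.sum_eq_single (Fin.last d)]
    · simp [hv]
    · intro k _ hk
      simp [hv, hk]
    · simp

/-- Bounds on the second-order behaviour of `γ` along coordinate directions, with first-order
coefficients `c`. -/
structure HasSlopes (S : Set (EuclideanSpace ℝ (Fin d))) (M : ℝ)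
    (γ : EuclideanSpace ℝ (Fin d) → ℝ) (c : EuclideanSpace ℝ (Fin d) → Fin d → ℝ) : Prop where
  measurable : Measurable γ
  measurable_slope : ∀ j, Measurable fun x => c x j
  abs_slope_sub_le : ∀ x ∈ S, ∀ j, ∀ u : ℝ, x + u • EuclideanSpace.single j 1 ∈ S → ∀ i,
    |c (x + u • EuclideanSpace.single j 1) i - c x i| ≤ M * |u|
  abs_sub_le : ∀ x ∈ S, ∀ j, ∀ u : ℝ, x + u • EuclideanSpace.single j 1 ∈ S →
    |γ (x + u • EuclideanSpace.single j 1) - γ x - c x j * u| ≤ M * u ^ 2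

theorem xpart_shear (j : Fin d) (u : ℝ) (w : EuclideanSpace ℝ (Fin d) → ℝ)
    (q : EuclideanSpace ℝ (Fin (d + 1))) :
    xpart (shear (u • EuclideanSpace.single (Fin.castSucc j) 1) w q) =
      xpart q + u • EuclideanSpace.single j 1 := by
  ext k
  simp [xpart_apply, shear]

theorem ypart_shear (j : Fin d) (u : ℝ) (w : EuclideanSpace ℝ (Fin d) → ℝ)
    (q : EuclideanSpace ℝ (Fin (d + 1))) :
    ypart (shear (u • EuclideanSpace.single (Fin.castSucc j) 1) w q) =
      ypart q + w (xpart q) := by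
  simp [ypart, shear]

/-- A tangential derivative is the derivative along a downward parabola. -/
theorem exists_polynomial_along_parabola (F : MvPolynomial (Fin (d + 1)) ℝ) {n : ℕ}
    (hF : F.totalDegree ≤ n) (c : Fin d → ℝ) (j : Fin d) (M : ℝ)
    (q : EuclideanSpace ℝ (Fin (d + 1))) {w : ℝ → EuclideanSpace ℝ (Fin d) → ℝ}
    (hw : ∀ t, w t (xpart q) = c j * t - M * t ^ 2) :
    ∃ R : Polynomial ℝ, R.natDegree ≤ 2 * n ∧
      (∀ t : ℝ, R.eval t = eval (fun k =>
        shear (t • EuclideanSpace.single (Fin.castSucc j) 1) (w t) q k) F) ∧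
      R.derivative.eval 0 = eval (fun k => q k) (tanDir c j F) := by
  obtain ⟨v, hv⟩ : ∃ v, v = lastVec d := ⟨_, rfl⟩
  obtain ⟨v', hv'⟩ : ∃ v' : EuclideanSpace ℝ (Fin (d + 1)),
    v' = EuclideanSpace.single (Fin.castSucc j) 1 := ⟨_, rfl⟩
  obtain ⟨R, h1, h2, h3⟩ := exists_polynomial_along_curve F hF q (m := 2)
    (fun k => Polynomial.C (q k) + Polynomial.C (v' k + c j * v k) * Polynomial.X
      - Polynomial.C (M * v k) * Polynomial.X ^ 2)
    (fun k => by compute_degree) (fun k => by simp)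
  refine ⟨R, h1, fun t => ?_, ?_⟩
  · rw [h2]
    congr 2
    ext k
    simp only [shear, hw, ← hv, ← hv']
    simp
    ring
  · rw [h3, tanDir_apply, map_add, smul_eval]
    have e : ∀ k, (Polynomial.C (q k) + Polynomial.C (v' k + c j * v k) * Polynomial.X
        - Polynomial.C (M * v k) * Polynomial.X ^ 2).derivative.eval 0 = v' k + c j * v k := by
      intro k
      simp only [Polynomial.derivative_add, Polynomial.derivative_sub, Polynomial.derivative_C,
        Polynomial.derivative_C_mul, Polynomial.derivative_X, Polynomial.derivative_X_pow]
      simp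
    simp only [e, mul_add, Finset.sum_add_distrib]
    simp [hv, hv', mul_comm]

theorem depth_shear_mem {S : Set (EuclideanSpace ℝ (Fin d))} {M : ℝ}
    {γ : EuclideanSpace ℝ (Fin d) → ℝ} {c : EuclideanSpace ℝ (Fin d) → Fin d → ℝ}
    (h : HasSlopes S M γ c) (j : Fin d) (u : ℝ) {q : EuclideanSpace ℝ (Fin (d + 1))}
    (hq : xpart q ∈ S) (hq' : xpart q + u • EuclideanSpace.single j 1 ∈ S) :
    depth γ (shear (u • EuclideanSpace.single (Fin.castSucc j) 1)
      (fun x => c x j * u - M * u ^ 2) q) ∈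
      Set.Icc (depth γ q) (depth γ q + 2 * M * u ^ 2) := by
  have := abs_le.1 (h.abs_sub_le _ hq j u hq')
  simp only [depth, xpart_shear, ypart_shear]
  constructor <;> linarith [this.1, this.2]

theorem shear_mem_graphDomain {M r s a : ℝ} (ha : 1 ≤ a) (hrs : r < s)
    (hs : s ≤ 2)
    {γ : EuclideanSpace ℝ (Fin d) → ℝ} {c : EuclideanSpace ℝ (Fin d) → Fin d → ℝ}
    (h : HasSlopes (cube d (2 * a)) M γ c) (j : Fin d) {u : ℝ} (hu : |u| ≤ s - r)
    (hu' : 2 * M * u ^ 2 ≤ s - r)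
    {q : EuclideanSpace ℝ (Fin (d + 1))} (hq : q ∈ graphDomain γ (r * a)) :
    xpart q ∈ cube d (2 * a) ∧ xpart q + u • EuclideanSpace.single j 1 ∈ cube d (2 * a) ∧
      shear (u • EuclideanSpace.single (Fin.castSucc j) 1)
        (fun x => c x j * u - M * u ^ 2) q ∈ graphDomain γ (s * a) := by
  rw [mem_graphDomain] at hq
  have hle : r * a ≤ s * a := by nlinarith
  have hsa : s * a ≤ 2 * a := by nlinarith
  have hx : ∀ k, (xpart q + u • EuclideanSpace.single j 1 : EuclideanSpace ℝ (Fin d)) k ∈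
      Set.Ioo (-(s * a)) (s * a) := by
    intro k
    have h1 := hq.1 k
    have h2 := abs_le.1 hu
    by_cases hk : k = j
    · subst hk
      simp only [PiLp.add_apply, PiLp.smul_apply, PiLp.single_apply, if_true,
        smul_eq_mul, mul_one]
      have h3 : s - r ≤ (s - r) * a := by nlinarith
      constructor <;> nlinarith [h1.1, h1.2]
    · simp only [PiLp.add_apply, PiLp.smul_apply, PiLp.single_apply, hk, if_false,
        smul_zero, add_zero]
      exact Set.Ioo_subset_Ioo (neg_le_neg hle) hle h1
  have h1 : xpart q ∈ cube d (2 * a) := fun k =>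
    Set.Ioo_subset_Icc_self (Set.Ioo_subset_Ioo (neg_le_neg (hle.trans hsa)) (hle.trans hsa)
      (hq.1 k))
  have h2 : xpart q + u • EuclideanSpace.single j 1 ∈ cube d (2 * a) := fun k =>
    Set.Ioo_subset_Icc_self (Set.Ioo_subset_Ioo (neg_le_neg hsa) hsa (hx k))
  obtain ⟨h3, h4⟩ := depth_shear_mem h j u h1 h2
  refine ⟨h1, h2, mem_graphDomain.2 ⟨?_, ?_, hq.2.2.trans h3⟩⟩
  · rwa [xpart_shear]
  · nlinarith [hq.2.1]

/-- Pointwise bound of a tangential derivative by lower-order derivatives at nodes. -/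
theorem abs_tanFun_cons_le {M : ℝ} (hM : 0 ≤ M) {S : Set (EuclideanSpace ℝ (Fin d))}
    {γ : EuclideanSpace ℝ (Fin d) → ℝ} {c : EuclideanSpace ℝ (Fin d) → Fin d → ℝ}
    (h : HasSlopes S M γ c) (j : Fin d) (l : List (Fin d))
    {P : MvPolynomial (Fin (d + 1)) ℝ} {n K : ℕ} (hP : P.totalDegree ≤ n) {u b : Fin K → ℝ}
    (hb : ∀ k, 0 ≤ b k)
    (hQ : ∀ Q : Polynomial ℝ, Q.natDegree ≤ 2 * n →
      |Q.derivative.eval 0| ≤ n * ∑ k, b k * |Q.eval (u k)|)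
    {q : EuclideanSpace ℝ (Fin (d + 1))} (hq : xpart q ∈ S)
    (hq' : ∀ k, xpart q + u k • EuclideanSpace.single j 1 ∈ S) :
    |tanFun c (j :: l) P q| ≤ n * ∑ k : Fin K × Fin l.sublists'.length,
      b k.1 * (M * |u k.1|) ^ (l.length - l.sublists'[k.2].length) *
        |tanFun c l.sublists'[k.2]
          ((pderiv (Fin.last d))^[l.length - l.sublists'[k.2].length] P)
          (shear (u k.1 • EuclideanSpace.single (Fin.castSucc j) 1)
            (fun x => c x j * u k.1 - M * u k.1 ^ 2) q)| := by
  obtain ⟨R, h1, h2, h3⟩ := exists_polynomial_along_parabola (tanList (c (xpart q)) l P)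
    ((totalDegree_tanList_le _ _ _).trans hP) (c (xpart q)) j M q
    (w := fun t x => c x j * t - M * t ^ 2) (fun t => rfl)
  rw [tanFun, tanList_cons, ← h3, Fintype.sum_prod_type]
  refine (hQ R h1).trans ?_
  gcongr with k _
  simp only [mul_assoc]
  rw [← Finset.mul_sum]
  refine mul_le_mul_of_nonneg_left ?_ (hb k)
  rw [h2]
  set q₁ := shear (u k • EuclideanSpace.single (Fin.castSucc j) 1)
    (fun x => c x j * u k - M * u k ^ 2) q with hq₁
  have hx : xpart q₁ = xpart q + u k • EuclideanSpace.single j 1 := xpart_shear _ _ _ _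
  have h4 := abs_tanList_le_sum_sublists (c := c (xpart q)) (c' := c (xpart q₁))
    (η := M * |u k|) (by positivity) (fun i => by
      rw [abs_sub_comm, hx]
      exact h.abs_slope_sub_le _ hq j (u k) (hq' k) i) l
    (aeval fun k => q₁ k : MvPolynomial (Fin (d + 1)) ℝ →ₐ[ℝ] ℝ).toLinearMap P
  rw [← Fin.sum_univ_fun_getElem] at h4
  exact h4

/-- Bounds for iterated tangential derivatives of iterated vertical derivatives. -/
theorem exists_tangential_bound {p : ℝ≥0∞} (hp : p ≠ 0) {M : ℝ} (hM : 0 ≤ M) (l : List (Fin d))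
    (m : ℕ) {r s : ℝ} (hr : 0 ≤ r) (hrs : r < s) (hs : s ≤ 2) :
    ∃ C : ℝ, 0 ≤ C ∧ ∀ a : ℝ, 1 ≤ a → ∀ (γ : EuclideanSpace ℝ (Fin d) → ℝ)
      (c : EuclideanSpace ℝ (Fin d) → Fin d → ℝ), HasSlopes (cube d (2 * a)) M γ c →
      ∀ n : ℕ, 0 < n → ∀ P : MvPolynomial (Fin (d + 1)) ℝ, P.totalDegree ≤ n →
        eLpNorm (tanFun c l ((pderiv (Fin.last d))^[m] P)) p
            (volume.restrict (graphDomain γ (r * a))) ≤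
          ENNReal.ofReal (C * n ^ (l.length + 2 * m)) *
            eLpNorm (fun q => eval (fun k => q k) P) p
              (volume.restrict (graphDomain γ (s * a))) := by
  induction hlen : l.length using Nat.strong_induction_on generalizing l m r with
  | _ N ih =>
    subst hlen
    match l with
    | [] =>
      obtain ⟨C, hC, h⟩ := exists_vertical_bound (d := d) hp 0 m hr hrs hs
      refine ⟨C, hC, fun a ha γ c hc n hn P hP => ?_⟩
      have := h a ha γ hc.measurable n hn (fun k => tanFun c [] ((pderiv (Fin.last d))^[k] P))
        (fun k => by
          simp only [Function.iterate_succ_apply']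
          exact hasVerticalDeriv_tanFun hc.measurable_slope []
            ((totalDegree_iterate_pderiv_le _ _ _).trans hP))
      simp only [pow_zero, one_mul, zero_add] at this
      rw [List.length_nil, zero_add]
      exact this
    | j :: l =>
      obtain ⟨t, hrt, hts⟩ := exists_between hrs
      have hlen : ∀ i : Fin l.sublists'.length, l.sublists'[i].length ≤ l.length := fun i =>
        (List.mem_sublists'.1 (List.getElem_mem i.2)).length_le
      choose D hD0 hD using fun i : Fin l.sublists'.length =>
        ih l.sublists'[i].length (by rw [List.length_cons]; exact Nat.lt_succ_of_le (hlen i))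
          l.sublists'[i] (l.length - l.sublists'[i].length + m) (hr.trans hrt.le) hts rfl
      obtain ⟨δ, hδ0, hδ1, hδ2⟩ : ∃ δ : ℝ, 0 < δ ∧ δ ≤ t - r ∧ 2 * M * δ ^ 2 ≤ t - r := by
        have h0 : 0 < t - r := sub_pos.2 hrt
        refine ⟨min 1 ((t - r) / (2 * M + 1)), by positivity, ?_, ?_⟩
        · refine (min_le_right _ _).trans (div_le_self h0.le (by linarith))
        · have h1 := min_le_left 1 ((t - r) / (2 * M + 1))
          have h2 := min_le_right 1 ((t - r) / (2 * M + 1))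
          have h3 : 0 < min 1 ((t - r) / (2 * M + 1)) := by positivity
          rw [le_div_iff₀ (by positivity)] at h2
          set δ := min 1 ((t - r) / (2 * M + 1))
          have h4 : M * δ ^ 2 ≤ M * δ := by
            refine mul_le_mul_of_nonneg_left ?_ hM
            nlinarith
          nlinarith
      obtain ⟨B, hB0, hB⟩ := exists_derivative_nodes hδ0 (subaddExp_pos hp) l.length
      set W : ℝ := ∑ i : Fin l.sublists'.length,
        (M ^ (l.length - l.sublists'[i].length) * D i) ^ subaddExp p with hW
      have hW0 : 0 ≤ W := Finset.sum_nonneg fun i _ => by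
        have := hD0 i
        positivity
      refine ⟨(B * W) ^ (1 / subaddExp p), by positivity, fun a ha γ c hc n hn P hP => ?_⟩
      have hn' : (0 : ℝ) < n := by exact_mod_cast hn
      obtain ⟨K, u, b, hu, hb, hsum, hQ⟩ := hB n hn
      set Y := eLpNorm (fun q => eval (fun k => q k) P) p
        (volume.restrict (graphDomain γ (s * a))) with hY
      have hPm : ((pderiv (Fin.last d))^[m] P).totalDegree ≤ n :=
        (totalDegree_iterate_pderiv_le _ _ _).trans hP
      have hmem : ∀ k, ∀ q ∈ graphDomain γ (r * a), _ := fun k q hq =>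
        shear_mem_graphDomain ha hrt (hts.le.trans hs) hc j (u := u k)
        ((hu k).trans hδ1) (by
          refine le_trans ?_ hδ2
          rw [← sq_abs]
          have := hu k
          gcongr) hq
      have hw : ∀ k, Measurable fun x => c x j * u k - M * u k ^ 2 := fun k =>
        ((hc.measurable_slope j).mul_const _).sub_const _
      have := eLpNorm_le_of_pointwise_scaled (μ := volume)
        (ι := Fin K × Fin l.sublists'.length) (N := fun _ => 1)
        (A := graphDomain γ (r * a)) (A' := graphDomain γ (t * a))
        (T := fun k => shear (u k.1 • EuclideanSpace.single (Fin.castSucc j) 1)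
          (fun x => c x j * u k.1 - M * u k.1 ^ 2))
        (b := fun k => b k.1 * (M * |u k.1|) ^ (l.length - l.sublists'[k.2].length))
        (D := fun k => D k.2 * n ^ (l.length - l.sublists'[k.2].length))
        (κ := n) (Y := ENNReal.ofReal (n ^ (l.length + 2 * m)) * Y) (C := B * W)
        (F := tanFun c (j :: l) ((pderiv (Fin.last d))^[m] P))
        (G := fun k => tanFun c l.sublists'[k.2]
          ((pderiv (Fin.last d))^[l.length - l.sublists'[k.2].length]
            ((pderiv (Fin.last d))^[m] P)))
        hp (measurableSet_graphDomain hc.measurable _)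
        (fun k => measurable_tanFun hc.measurable_slope _ _)
        (fun k => (measurePreserving_shear _ (hw k.1)).measurable)
        (fun _ => le_rfl)
        (fun k => map_restrict_le_of_measurePreserving
          (measurableSet_graphDomain hc.measurable _) (measurePreserving_shear _ (hw k.1))
          fun q hq => (hmem k.1 q hq).2.2)
        (fun k => mul_nonneg (hb _) (by positivity))
        (fun k => mul_nonneg (hD0 _) (by positivity)) hn'.le ?_ ?_ ?_
      · refine this.trans (le_of_eq ?_)
        rw [← mul_assoc, ← ENNReal.ofReal_mul (by positivity)]
        congr 2
        rw [List.length_cons]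
        ring
      · intro q hq
        refine abs_tanFun_cons_le hM hc j l hPm hb hQ ?_ fun k => (hmem k q hq).2.1
        rw [mem_graphDomain] at hq
        intro k
        have h1 := hq.1 k
        constructor <;> nlinarith [h1.1, h1.2]
      · intro k
        have := hD k.2 a ha γ c hc n hn P hP
        simp only [Function.iterate_add_apply] at this
        refine this.trans (le_of_eq ?_)
        rw [← mul_assoc, ← ENNReal.ofReal_mul (mul_nonneg (hD0 _) (by positivity)), mul_assoc,
          ← pow_add]
        congr 4
        have := hlen k.2
        omega
      · simp only [Nat.cast_one, mul_one]
        calc ∑ k : Fin K × Fin l.sublists'.length,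
              (b k.1 * (M * |u k.1|) ^ (l.length - l.sublists'[k.2].length) *
                (D k.2 * n ^ (l.length - l.sublists'[k.2].length))) ^ subaddExp p
            ≤ ∑ k : Fin K × Fin l.sublists'.length,
              (b k.1 * (1 + n * |u k.1|) ^ l.length) ^ subaddExp p *
                (M ^ (l.length - l.sublists'[k.2].length) * D k.2) ^ subaddExp p := by
              refine Finset.sum_le_sum fun k _ => ?_
              have h1 := hb k.1
              have h2 := hD0 k.2
              rw [← Real.mul_rpow (by positivity) (by positivity)]
              refine Real.rpow_le_rpow (by positivity) ?_ (subaddExp_pos hp).le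
              have h3 : (n * |u k.1|) ^ (l.length - l.sublists'[k.2].length) ≤
                  (1 + n * |u k.1|) ^ l.length := by
                have h4 : 0 ≤ n * |u k.1| := by positivity
                calc (n * |u k.1|) ^ (l.length - l.sublists'[k.2].length)
                    ≤ (1 + n * |u k.1|) ^ (l.length - l.sublists'[k.2].length) := by
                      gcongr
                      linarith
                  _ ≤ _ := pow_le_pow_right₀ (by linarith) (Nat.sub_le _ _)
              calc _ = b k.1 * (M ^ (l.length - l.sublists'[k.2].length) * D k.2) *
                    (n * |u k.1|) ^ (l.length - l.sublists'[k.2].length) := by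
                    rw [mul_pow, mul_pow]
                    ring
                _ ≤ b k.1 * (M ^ (l.length - l.sublists'[k.2].length) * D k.2) *
                    (1 + n * |u k.1|) ^ l.length := by gcongr
                _ = _ := by ring
          _ = (∑ k, (b k * (1 + n * |u k|) ^ l.length) ^ subaddExp p) * W := by
              rw [hW, Finset.sum_mul_sum, Fintype.sum_prod_type]
          _ ≤ B * W := by gcongr

/-- Weighted bounds for mixed tangential and vertical derivatives. -/
theorem exists_mixed_bound {p : ℝ≥0∞} (hp : p ≠ 0) {M : ℝ} (hM : 0 ≤ M) (l : List (Fin d))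
    (i j : ℕ) {r s : ℝ} (hr : 0 ≤ r) (hrs : r < s) (hs : s ≤ 2) :
    ∃ C : ℝ, 0 ≤ C ∧ ∀ a : ℝ, 1 ≤ a → ∀ (γ : EuclideanSpace ℝ (Fin d) → ℝ)
      (c : EuclideanSpace ℝ (Fin d) → Fin d → ℝ), HasSlopes (cube d (2 * a)) M γ c →
      ∀ n : ℕ, 0 < n → ∀ P : MvPolynomial (Fin (d + 1)) ℝ, P.totalDegree ≤ n →
        eLpNorm (fun q => weight γ n q ^ i * tanFun c l ((pderiv (Fin.last d))^[i + j] P) q) p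
            (volume.restrict (graphDomain γ (r * a))) ≤
          ENNReal.ofReal (C * n ^ (l.length + i + 2 * j)) *
            eLpNorm (fun q => eval (fun k => q k) P) p
              (volume.restrict (graphDomain γ (s * a))) := by
  obtain ⟨t, hrt, hts⟩ := exists_between hrs
  obtain ⟨C₁, hC₁, h₁⟩ := exists_vertical_bound (d := d) hp i j hr hrt (hts.le.trans hs)
  obtain ⟨C₂, hC₂, h₂⟩ := exists_tangential_bound hp hM l 0 (hr.trans hrt.le) hts hs
  refine ⟨C₁ * C₂, by positivity, fun a ha γ c hc n hn P hP => ?_⟩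
  have := eLpNorm_le_ofReal_mul_trans (by positivity)
    (h₁ a ha γ hc.measurable n hn (fun k => tanFun c l ((pderiv (Fin.last d))^[k] P))
      (fun k => by
        simp only [Function.iterate_succ_apply']
        exact hasVerticalDeriv_tanFun hc.measurable_slope l
          ((totalDegree_iterate_pderiv_le _ _ _).trans hP)))
    (h₂ a ha γ c hc n hn P hP)
  refine this.trans (le_of_eq ?_)
  congr 2
  ring

end Tangential

section SecondOrder

variable {E : Type*} [NormedAddCommGroup E] [NormedSpace ℝ E] {g : E → ℝ} {S : Set E}

theorem line_mem_of_mem_uIcc (hS : Convex ℝ S) {x v : E} {u t : ℝ} (hx : x ∈ S)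
    (hu : x + u • v ∈ S) (ht : t ∈ Set.uIcc 0 u) : x + t • v ∈ S := by
  have hT : Convex ℝ ((fun t : ℝ => x + t • v) ⁻¹' S) := by
    have h : (fun t : ℝ => x + t • v) = AffineMap.lineMap x (x + v) := by
      ext t
      simp [AffineMap.lineMap_apply, add_comm]
    rw [h]
    exact hS.affine_preimage (AffineMap.lineMap x (x + v) : ℝ →ᵃ[ℝ] E)
  exact hT.ordConnected.uIcc_subset (by simpa using hx) hu ht

theorem hasDerivAt_line (x v : E) (t : ℝ) : HasDerivAt (fun t : ℝ => x + t • v) v t := by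
  simpa using ((hasDerivAt_id t).smul_const v).const_add x

theorem abs_fderivWithin_sub_le (hS : Convex ℝ S) (hS' : UniqueDiffOn ℝ S)
    (hg : ContDiffOn ℝ 2 g S) {M : ℝ} {v w : E}
    (hM : ∀ y ∈ S, |iteratedFDerivWithin ℝ 2 g S y ![v, w]| ≤ M) {x : E} {u : ℝ} (hx : x ∈ S)
    (hu : x + u • v ∈ S) :
    |fderivWithin ℝ g S (x + u • v) w - fderivWithin ℝ g S x w| ≤ M * |u| := by
  have hF : DifferentiableOn ℝ (fderivWithin ℝ g S) S :=
    (hg.fderivWithin hS' (m := 1) (by norm_num)).differentiableOn (by norm_num)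
  have hmaps : Set.MapsTo (fun t : ℝ => x + t • v) (Set.uIcc 0 u) S := fun t ht =>
    line_mem_of_mem_uIcc hS hx hu ht
  have hd : ∀ t ∈ Set.uIcc 0 u,
      HasDerivWithinAt (fun t : ℝ => fderivWithin ℝ g S (x + t • v) w)
        (fderivWithin ℝ (fderivWithin ℝ g S) S (x + t • v) v w) (Set.uIcc 0 u) t := fun t ht => by
    have h1 := (hF _ (hmaps ht)).hasFDerivWithinAt.comp_hasDerivWithinAt t
      (hasDerivAt_line x v t).hasDerivWithinAt hmaps
    simpa using h1.clm_apply (hasDerivWithinAt_const t (Set.uIcc 0 u) w)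
  have hb : ∀ t ∈ Set.uIcc 0 u,
      ‖fderivWithin ℝ (fderivWithin ℝ g S) S (x + t • v) v w‖ ≤ M := fun t ht => by
    have := hM _ (hmaps ht)
    rwa [iteratedFDerivWithin_two_apply g hS' (hmaps ht)] at this
  simpa using (convex_uIcc 0 u).norm_image_sub_le_of_norm_hasDerivWithin_le hd hb
    Set.left_mem_uIcc Set.right_mem_uIcc

theorem abs_sub_fderivWithin_le (hS : Convex ℝ S) (hS' : UniqueDiffOn ℝ S)
    (hg : ContDiffOn ℝ 2 g S) {M : ℝ} (hM0 : 0 ≤ M) {v : E}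
    (hM : ∀ y ∈ S, |iteratedFDerivWithin ℝ 2 g S y ![v, v]| ≤ M) {x : E} {u : ℝ} (hx : x ∈ S)
    (hu : x + u • v ∈ S) :
    |g (x + u • v) - g x - fderivWithin ℝ g S x v * u| ≤ M * u ^ 2 := by
  have hmaps : Set.MapsTo (fun t : ℝ => x + t • v) (Set.uIcc 0 u) S := fun t ht =>
    line_mem_of_mem_uIcc hS hx hu ht
  have hd : ∀ t ∈ Set.uIcc 0 u,
      HasDerivWithinAt (fun t : ℝ => g (x + t • v) - fderivWithin ℝ g S x v * t)
        (fderivWithin ℝ g S (x + t • v) v - fderivWithin ℝ g S x v) (Set.uIcc 0 u) t :=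
    fun t ht => by
    have h1 := (hg.differentiableOn (by norm_num) _
      (hmaps ht)).hasFDerivWithinAt.comp_hasDerivWithinAt t
      (hasDerivAt_line x v t).hasDerivWithinAt hmaps
    have h2 := (hasDerivWithinAt_id t (Set.uIcc 0 u)).const_mul (fderivWithin ℝ g S x v)
    rw [mul_one] at h2
    exact h1.sub h2
  have hb : ∀ t ∈ Set.uIcc 0 u,
      ‖fderivWithin ℝ g S (x + t • v) v - fderivWithin ℝ g S x v‖ ≤ M * |u| := fun t ht => by
    refine (abs_fderivWithin_sub_le hS hS' hg hM hx (hmaps ht)).trans ?_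
    refine mul_le_mul_of_nonneg_left ?_ hM0
    simpa using Set.abs_sub_left_of_mem_uIcc ht
  have := (convex_uIcc 0 u).norm_image_sub_le_of_norm_hasDerivWithin_le hd hb
    Set.left_mem_uIcc Set.right_mem_uIcc
  rw [Real.norm_eq_abs, Real.norm_eq_abs, sub_zero, mul_assoc, abs_mul_abs_self, ← sq] at this
  convert this using 2
  simp
  ring

end SecondOrder

section Cube

variable {d : ℕ}

theorem convex_cube (b : ℝ) : Convex ℝ (cube d b) := by
  have : cube d b = ⋂ i, (EuclideanSpace.proj i : EuclideanSpace ℝ (Fin d) →L[ℝ] ℝ) ⁻¹'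
      Set.Icc (-b) b := by
    ext x
    simp [cube]
  rw [this]
  exact convex_iInter fun i => (convex_Icc (-b) b).linear_preimage
    (EuclideanSpace.proj i : EuclideanSpace ℝ (Fin d) →L[ℝ] ℝ).toLinearMap

theorem isClosed_cube (b : ℝ) : IsClosed (cube d b) := by
  have : cube d b = ⋂ i, (EuclideanSpace.proj i : EuclideanSpace ℝ (Fin d) →L[ℝ] ℝ) ⁻¹'
      Set.Icc (-b) b := by
    ext x
    simp [cube]
  rw [this]
  exact isClosed_iInter fun i => isClosed_Icc.preimage (EuclideanSpace.proj i).continuous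

theorem uniqueDiffOn_cube {b : ℝ} (hb : 0 < b) : UniqueDiffOn ℝ (cube d b) := by
  refine uniqueDiffOn_convex (convex_cube b) ⟨0, mem_interior.2
    ⟨Metric.ball 0 b, fun x hx i => ?_, Metric.isOpen_ball, Metric.mem_ball_self hb⟩⟩
  rw [mem_ball_zero_iff] at hx
  exact abs_le.1 ((PiLp.norm_apply_le x i).trans hx.le)

theorem measurable_indicator_cube {b : ℝ} {f : EuclideanSpace ℝ (Fin d) → ℝ}
    (hf : ContinuousOn f (cube d b)) : Measurable ((cube d b).indicator f) := by
  classical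
  rw [← Set.piecewise_eq_indicator]
  exact hf.measurable_piecewise continuousOn_const (isClosed_cube b).measurableSet

/-- The first-order coefficients of `g` on the cube `[-b,b]^d`, extended by zero. -/
def cubeSlope (b : ℝ) (g : EuclideanSpace ℝ (Fin d) → ℝ) (x : EuclideanSpace ℝ (Fin d))
    (j : Fin d) : ℝ :=
  (cube d b).indicator (fun x => fderivWithin ℝ g (cube d b) x (EuclideanSpace.single j 1)) x

theorem hasSlopes_cube {b M : ℝ} (hb : 0 < b) (hM : 0 ≤ M) {g : EuclideanSpace ℝ (Fin d) → ℝ}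
    (hg : ContDiffOn ℝ 2 g (cube d b))
    (h : ∀ x ∈ cube d b, ∀ i j : Fin d, |iteratedFDerivWithin ℝ 2 g (cube d b) x
      ![EuclideanSpace.single i 1, EuclideanSpace.single j 1]| ≤ M) :
    HasSlopes (cube d b) M ((cube d b).indicator g) (cubeSlope b g) where
  measurable := measurable_indicator_cube hg.continuousOn
  measurable_slope j := measurable_indicator_cube
    ((hg.continuousOn_fderivWithin (uniqueDiffOn_cube hb) (by norm_num)).clm_apply
      continuousOn_const)
  abs_slope_sub_le x hx j u hu i := by
    rw [cubeSlope, cubeSlope, Set.indicator_of_mem hx, Set.indicator_of_mem hu]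
    exact abs_fderivWithin_sub_le (convex_cube b) (uniqueDiffOn_cube hb) hg
      (fun y hy => h y hy j i) hx hu
  abs_sub_le x hx j u hu := by
    rw [cubeSlope, Set.indicator_of_mem hx, Set.indicator_of_mem hx, Set.indicator_of_mem hu]
    exact abs_sub_fderivWithin_le (convex_cube b) (uniqueDiffOn_cube hb) hg hM
      (fun y hy => h y hy j j) hx hu

theorem xpart_mem_cube {t b : ℝ} (htb : t ≤ b) {q : EuclideanSpace ℝ (Fin (d + 1))}
    (hq : ∀ k, xpart q k ∈ Set.Ioo (-t) t) : xpart q ∈ cube d b := fun k =>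
  ⟨(neg_le_neg htb).trans (hq k).1.le, (hq k).2.le.trans htb⟩

theorem graphDomain_indicator {t b : ℝ} (htb : t ≤ b) (g : EuclideanSpace ℝ (Fin d) → ℝ) :
    graphDomain ((cube d b).indicator g) t = {q | (∀ k, xpart q k ∈ Set.Ioo (-t) t) ∧
      g (xpart q) - t < ypart q ∧ ypart q ≤ g (xpart q)} := by
  ext q
  refine and_congr_right fun hq => ?_
  rw [Set.indicator_of_mem (xpart_mem_cube htb hq)]

end Cube

/-- Theorem `thm:2d bern-2`, Dai–Prymak.
Mixed tangential Bernstein inequality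
`‖φ_n^i D_tan^α ∂_{d+1}^{i+j} f‖_{L^p(G)} ≤ c n^{|α|+i+2j} ‖f‖_{L^p(G(λ))}`
on a domain of special type in `ℝ^{d+1}`. -/
theorem statement16 (d : ℕ) (hd : 0 < d) (p : ℝ≥0∞) (hp : 0 < p)
    (lam M : ℝ) (hlam : 1 < lam ∧ lam ≤ 2) (hM : 10 < M)
    (α : Fin d → ℕ) (i j : ℕ) :
    ∃ c : ℝ≥0, 0 < c ∧
      ∀ a : ℝ, 1 ≤ a →
      ∀ g : EuclideanSpace ℝ (Fin d) → ℝ, ContDiffOn ℝ 2 g (cube d (2 * a)) →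
        (∀ x ∈ cube d (2 * a), 4 * a ≤ g x) →
        (∀ x ∈ cube d (2 * a), ∀ i' j' : Fin d,
          |iteratedFDerivWithin ℝ 2 g (cube d (2 * a)) x
              ![EuclideanSpace.single i' 1, EuclideanSpace.single j' 1]| ≤ M) →
        ‖fderivWithin ℝ g (cube d (2 * a)) 0‖ ≤ M →
      ∀ n : ℕ, 0 < n →
      ∀ P : MvPolynomial (Fin (d + 1)) ℝ, P.totalDegree ≤ n →
        eLpNorm (fun q : EuclideanSpace ℝ (Fin (d + 1)) =>
            (Real.sqrt (g (xpart q) - ypart q) + 1 / n) ^ i *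
              MvPolynomial.eval (fun k => q k)
                (tanOpD (fun j' => fderivWithin ℝ g (cube d (2 * a)) (xpart q)
                    (EuclideanSpace.single j' 1)) α
                  ((MvPolynomial.pderiv (Fin.last d))^[i + j] P)))
          p (volume.restrict
            {q : EuclideanSpace ℝ (Fin (d + 1)) |
              (∀ k, xpart q k ∈ Set.Ioo (-a) a) ∧
              g (xpart q) - a < ypart q ∧ ypart q ≤ g (xpart q)}) ≤
        (c : ℝ≥0∞) * (n : ℝ≥0∞) ^ ((∑ k, α k) + i + 2 * j) *
          eLpNorm (fun q : EuclideanSpace ℝ (Fin (d + 1)) =>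
              MvPolynomial.eval (fun k => q k) P)
            p (volume.restrict
              {q : EuclideanSpace ℝ (Fin (d + 1)) |
                (∀ k, xpart q k ∈ Set.Ioo (-(lam * a)) (lam * a)) ∧
                g (xpart q) - lam * a < ypart q ∧ ypart q ≤ g (xpart q)}) := by
  obtain ⟨l, hl, htan⟩ := exists_tanList_eq_tanOpD α
  obtain ⟨C, hC0, hC⟩ := exists_mixed_bound hp.ne' (by linarith : (0 : ℝ) ≤ M) l i j zero_le_one
    hlam.1 hlam.2
  refine ⟨C.toNNReal + 1, by positivity, fun a ha g hg _ hM2 _ n hn P hP => ?_⟩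
  have hslopes := hasSlopes_cube (by linarith) (by linarith) hg hM2
  have key := hC a ha _ _ hslopes n hn P hP
  rw [one_mul, hl, graphDomain_indicator (by linarith),
    graphDomain_indicator (by nlinarith [hlam.2])] at key
  refine (le_of_eq ?_).trans (key.trans (mul_le_mul_left ?_ _))
  · refine eLpNorm_congr_ae ((ae_restrict_iff' ?_).2 (Filter.Eventually.of_forall fun q hq => ?_))
    · rw [← graphDomain_indicator (b := 2 * a) (by linarith)]
      exact measurableSet_graphDomain hslopes.measurable _
    · have hx := xpart_mem_cube (b := 2 * a) (by linarith) hq.1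
      have hslope : cubeSlope (2 * a) g (xpart q) = fun j' =>
          fderivWithin ℝ g (cube d (2 * a)) (xpart q) (EuclideanSpace.single j' 1) :=
        funext fun _ => Set.indicator_of_mem hx _
      simp only [weight, depth, tanFun, htan, hslope, Set.indicator_of_mem hx]
  · rw [ENNReal.ofReal_mul hC0, ENNReal.ofReal_pow (Nat.cast_nonneg n), ENNReal.ofReal_natCast]
    gcongr
    exact ENNReal.coe_le_coe.2 (le_add_of_nonneg_right zero_le_one)
end
end

section
/- Let n, r ∈ ℕ, let ξ₁, …, ξ_r ∈ ℝ^n and let f ∈ C^r(ℝ^n). Writing ∂_ξ := ξ·∇ for the directional derivative along a (not necessarily unit) vector ξ ∈ ℝ^n, one has the identity ∂_{ξ₁}∂_{ξ₂}⋯∂_{ξ_r} f = Σ_{S ⊆ {1,…,r}} (−1)^{|S|} ∂_{ξ_S}^r f, where the sum extends over all subsets S of {1,…,r}, |S| is the cardinality of S, and ξ_S := −Σ_{j∈S} j^{−1} ξ_j (with ξ_∅ = 0). -/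
open MeasureTheory ENNReal NNReal

noncomputable section

/-- directional derivative `∂_v f = v·∇f` along a (not necessarily unit) vector `v` -/
def dirDeriv {n : ℕ} (v : EuclideanSpace ℝ (Fin n)) (f : EuclideanSpace ℝ (Fin n) → ℝ) :
    EuclideanSpace ℝ (Fin n) → ℝ :=
  fun x => fderiv ℝ f x v

open Finset in
theorem Finset.sum_ite_range_subset_neg_one_pow_card {ι κ R : Type*} [Fintype ι]
    [Fintype κ] [DecidableEq κ] [CommRing R] (p : ι → κ) :
    (∑ S : Finset κ, (-1 : R) ^ #S * if ∀ i, p i ∈ S then 1 else 0) =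
      if p.Surjective then (-1) ^ Fintype.card κ else 0 := by
  classical
  have key : ∀ S : Finset κ, (∏ j ∈ univ \ S, if j ∈ Set.range p then (0 : R) else 1) =
      if ∀ i, p i ∈ S then 1 else 0 := by
    intro S
    split_ifs with h
    · refine prod_eq_one fun j hj => if_neg ?_
      rintro ⟨i, rfl⟩
      exact (mem_sdiff.1 hj).2 (h i)
    · push Not at h
      obtain ⟨i, hi⟩ := h
      exact prod_eq_zero (i := p i) (by simpa using hi) (if_pos ⟨i, rfl⟩)
  have h := prod_add (fun _ : κ => (-1 : R)) (fun j => if j ∈ Set.range p then (0 : R) else 1) univ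
  simp only [key, prod_const, powerset_univ] at h
  rw [← h]
  split_ifs with hp
  · rw [← card_univ, ← prod_const]
    exact prod_congr rfl fun j _ => by rw [if_pos (Set.mem_range.2 (hp j)), add_zero]
  · rw [Function.Surjective] at hp
    push Not at hp
    obtain ⟨j, hj⟩ := hp
    refine prod_eq_zero (mem_univ j) ?_
    rw [if_neg (by simpa using hj), neg_add_cancel]

open Finset in
/-- The polarization identity for a symmetric multilinear map. -/
theorem MultilinearMap.sum_neg_one_pow_card_smul_map_sum {R ι M N : Type*} [CommRing R]
    [Fintype ι] [DecidableEq ι] [AddCommGroup M] [Module R M] [AddCommGroup N] [Module R N]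
    (F : MultilinearMap R (fun _ : ι => M) N) (a : ι → M)
    (hF : ∀ σ : Equiv.Perm ι, F (fun i => a (σ i)) = F a) :
    ∑ S : Finset ι, (-1 : R) ^ #S • F (fun _ => ∑ j ∈ S, a j) =
      ((-1) ^ Fintype.card ι * (Fintype.card ι).factorial : R) • F a := by
  have expand : ∀ S : Finset ι, F (fun _ => ∑ j ∈ S, a j) =
      ∑ p : ι → ι, (if ∀ i, p i ∈ S then (1 : R) else 0) • F (fun i => a (p i)) := by
    intro S
    rw [F.map_sum_finset (fun _ => a) fun _ => S]
    simp only [ite_smul, one_smul, zero_smul, ← sum_filter]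
    exact sum_congr (by ext; simp) fun _ _ => rfl
  simp only [expand, smul_sum, smul_smul]
  rw [sum_comm]
  simp only [← sum_smul, Finset.sum_ite_range_subset_neg_one_pow_card]
  rw [mul_comm, mul_smul, ← Fintype.card_perm, Nat.cast_smul_eq_nsmul,
    ← card_univ (α := Equiv.Perm ι), ← sum_const]
  symm
  refine sum_of_injOn (fun σ : Equiv.Perm ι => ⇑σ) DFunLike.coe_injective.injOn
    (fun _ _ => mem_univ _) (fun p _ hp => ?_) fun σ _ => ?_
  · rw [if_neg, zero_smul]
    intro hs
    exact hp ⟨Equiv.ofBijective p ⟨Finite.injective_iff_surjective.2 hs, hs⟩, by simp, rfl⟩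
  · rw [if_pos σ.surjective, hF]

section dirDeriv

variable {n : ℕ} {f : EuclideanSpace ℝ (Fin n) → ℝ}

theorem ContDiff.dirDeriv {k : ℕ} (hf : ContDiff ℝ (k + 1 : ℕ) f)
    (v : EuclideanSpace ℝ (Fin n)) : ContDiff ℝ k (dirDeriv v f) :=
  (hf.fderiv_right (by norm_cast)).clm_apply contDiff_const

theorem ContDiff.foldr_dirDeriv (l : List (EuclideanSpace ℝ (Fin n))) {k : ℕ}
    (hf : ContDiff ℝ (k + l.length : ℕ) f) : ContDiff ℝ k (l.foldr _root_.dirDeriv f) := by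
  induction l generalizing k with
  | nil => simpa using hf
  | cons v l ih =>
    refine ContDiff.dirDeriv (ih ?_) v
    rwa [List.length_cons, ← add_assoc, add_right_comm] at hf

theorem dirDeriv_comm (hf : ContDiff ℝ 2 f) (v w : EuclideanSpace ℝ (Fin n)) :
    dirDeriv v (dirDeriv w f) = dirDeriv w (dirDeriv v f) := by
  have hd : Differentiable ℝ (fderiv ℝ f) :=
    (hf.fderiv_right (m := 1) (by norm_num)).differentiable (by norm_num)
  have second : ∀ v w x, dirDeriv v (dirDeriv w f) x = fderiv ℝ (fderiv ℝ f) x v w := by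
    intro v w x
    change fderiv ℝ (fun y => fderiv ℝ f y w) x v = _
    rw [fderiv_clm_apply (hd x) (differentiableAt_const w)]
    simp
  ext x
  rw [second, second]
  exact (hf.contDiffAt.isSymmSndFDerivAt (by simp)) v w

theorem List.Perm.foldr_dirDeriv_eq {l l' : List (EuclideanSpace ℝ (Fin n))} (h : l.Perm l')
    (hf : ContDiff ℝ l.length f) : l.foldr dirDeriv f = l'.foldr dirDeriv f := by
  induction h with
  | nil => rfl
  | cons v _ ih =>
    rw [List.foldr_cons, List.foldr_cons,
      ih (hf.of_le (by simp only [List.length_cons]; norm_cast; lia))]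
  | swap v w l =>
    refine dirDeriv_comm (ContDiff.foldr_dirDeriv (k := 2) l (hf.of_le ?_)) w v
    simp only [List.length_cons]
    norm_cast
    lia
  | trans h₁ _ ih₁ ih₂ => rw [ih₁ hf, ih₂ (h₁.length_eq ▸ hf)]

theorem iteratedFDeriv_eq_foldr_dirDeriv {r : ℕ} (hf : ContDiff ℝ r f)
    (v : Fin r → EuclideanSpace ℝ (Fin n)) (x : EuclideanSpace ℝ (Fin n)) :
    iteratedFDeriv ℝ r f x v = (List.ofFn v).foldr dirDeriv f x := by
  induction r generalizing x with
  | zero => simp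
  | succ r ih =>
    have hd : Differentiable ℝ (iteratedFDeriv ℝ r f) :=
      hf.differentiable_iteratedFDeriv (by norm_cast; lia)
    have ih' : (List.ofFn fun i => v i.succ).foldr dirDeriv f =
        fun y => iteratedFDeriv ℝ r f y (Fin.tail v) :=
      funext fun y => (ih (hf.of_le (by norm_cast; lia)) (Fin.tail v) y).symm
    rw [List.ofFn_succ, List.foldr_cons, ih', iteratedFDeriv_succ_apply_left, dirDeriv,
      fderiv_continuousMultilinear_apply_const_apply (hd x)]

end dirDeriv

/-- Lemma `lem-11-3`, Dai–Prymak; Kemperman-type identity.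
`∂_{ξ₁}∂_{ξ₂}⋯∂_{ξ_r} f = Σ_{S ⊆ {1,…,r}} (−1)^{|S|} ∂_{ξ_S}^r f`
with `ξ_S = −Σ_{j∈S} j^{-1} ξ_j`. -/
theorem statement17 (n r : ℕ) (hr : 0 < r) (ξ : Fin r → EuclideanSpace ℝ (Fin n))
    (f : EuclideanSpace ℝ (Fin n) → ℝ) (hf : ContDiff ℝ (r : ℕ∞) f) :
    ∀ x : EuclideanSpace ℝ (Fin n),
      (List.ofFn ξ).foldr dirDeriv f x =
        ∑ S : Finset (Fin r), (-1 : ℝ) ^ S.card *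
          (dirDeriv (-(∑ j ∈ S, ((((j : ℕ) : ℝ) + 1)⁻¹ • ξ j))))^[r] f x := by
  intro x
  have hf' : ContDiff ℝ r f := hf
  set a : Fin r → EuclideanSpace ℝ (Fin n) := fun j => (((j : ℕ) : ℝ) + 1)⁻¹ • ξ j with ha
  let F := (iteratedFDeriv ℝ r f x).toMultilinearMap
  have symm : ∀ σ : Equiv.Perm (Fin r), F (fun i => a (σ i)) = F a := by
    intro σ
    change iteratedFDeriv ℝ r f x (a ∘ σ) = iteratedFDeriv ℝ r f x a
    rw [iteratedFDeriv_eq_foldr_dirDeriv hf', iteratedFDeriv_eq_foldr_dirDeriv hf',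
      (σ.ofFn_comp_perm a).foldr_dirDeriv_eq (by simpa using hf')]
  have prod_inv : (∏ j : Fin r, (((j : ℕ) : ℝ) + 1)⁻¹) = (r.factorial : ℝ)⁻¹ := by
    rw [Finset.prod_inv_distrib, Fin.prod_univ_eq_prod_range (fun j => (j : ℝ) + 1) r,
      ← Finset.prod_range_add_one_eq_factorial]
    push_cast
    rfl
  have scaled : F a = (r.factorial : ℝ)⁻¹ * F ξ := by
    rw [ha, F.map_smul_univ, prod_inv, smul_eq_mul]
  have diag : ∀ v : EuclideanSpace ℝ (Fin n),
      (dirDeriv (-v))^[r] f x = (-1) ^ r * F (fun _ => v) := by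
    intro v
    have h := F.map_smul_univ (fun _ => (-1 : ℝ)) (fun _ => v)
    simp only [neg_smul, one_smul, Finset.prod_const, Finset.card_univ, Fintype.card_fin,
      smul_eq_mul] at h
    rw [← h]
    change _ = iteratedFDeriv ℝ r f x _
    rw [iteratedFDeriv_eq_foldr_dirDeriv hf', List.ofFn_const]
    refine congrFun ?_ x
    clear * -
    induction r with
    | zero => rfl
    | succ r ih => rw [Function.iterate_succ_apply', ih, List.replicate_succ, List.foldr_cons]
  have polar := F.sum_neg_one_pow_card_smul_map_sum a symm
  simp only [smul_eq_mul, Fintype.card_fin] at polar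
  rw [← iteratedFDeriv_eq_foldr_dirDeriv hf']
  simp only [diag, mul_left_comm _ ((-1 : ℝ) ^ r)]
  rw [← Finset.mul_sum, polar, scaled]
  have h1 : ((-1 : ℝ) ^ r) * (-1) ^ r = 1 := by rw [← mul_pow]; simp
  have h2 : (r.factorial : ℝ) ≠ 0 := by positivity
  change F ξ = _
  field_simp
  rw [← pow_mul, mul_comm r, pow_mul]
  simp
end
end

section
/- Let r ∈ ℕ, h ∈ ℝ^d and δ₀ ∈ (0, 1). Let S, E be measurable subsets of ℝ^d with 0 < |E| < ∞, and assume that for each ξ ∈ S_{rh} := {ξ ∈ S : [ξ, ξ+rh] ⊆ S} there exists a convex subset E^ξ ⊆ E such that |E^ξ| ≥ δ₀|E| and [ξ, ξ+rh] ⊆ E^ξ. Then for every 0 < q ≤ p < ∞ and every measurable function f on S ∪ E with the right-hand side finite: ‖Δ_h^r(f, S, ·)‖_{L^p(S)} ≤ C(q, d, r) · ( ∫_S ( (δ₀|E|)^{−1} ∫_E |Δ_{(η−ξ)/r}^r(f, E, ξ)|^q dξ )^{p/q} dη )^{1/p}, where the constant C(q, d, r) is independent of S and E, and is independent of q when q ≥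 1. -/
open MeasureTheory ENNReal NNReal

noncomputable section

variable {n : ℕ}

/-- the `r`-th forward difference `Δ_ξ^r f(η)` -/
def fdiff (f : EuclideanSpace ℝ (Fin n) → ℝ) (ξ : EuclideanSpace ℝ (Fin n)) (r : ℕ)
    (η : EuclideanSpace ℝ (Fin n)) : ℝ :=
  ∑ j ∈ Finset.range (r + 1), (-1 : ℝ) ^ (r + j) * (r.choose j : ℝ) * f (η + (j : ℝ) • ξ)

/-- the restricted difference `Δ_ξ^r (f, Ω, η)` -/
def fdiffOn (f : EuclideanSpace ℝ (Fin n) → ℝ) (Ω : Set (EuclideanSpace ℝ (Fin n)))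
    (ξ : EuclideanSpace ℝ (Fin n)) (r : ℕ) (η : EuclideanSpace ℝ (Fin n)) : ℝ :=
  open Classical in
  if segment ℝ η (η + (r : ℝ) • ξ) ⊆ Ω then fdiff f ξ r η else 0

/-- Whitney's identity: an `r`-th difference at `x` in terms of differences in other directions. -/
theorem fdiff_eq_sum_fdiff_sub (f : EuclideanSpace ℝ (Fin n) → ℝ) (x h s : EuclideanSpace ℝ (Fin n))
    {r : ℕ} (hr : 0 < r) :
    fdiff f h r x = ∑ k ∈ Finset.Icc 1 r, (-1 : ℝ) ^ k * (r.choose k : ℝ) *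
      (fdiff f ((k : ℝ) • s) r (x + (k : ℝ) • h) - fdiff f (h + (k : ℝ) • s) r x) := by
  have hzero : fdiff f 0 r x = 0 := by
    have h1 := Int.alternating_sum_range_choose_of_ne hr.ne'
    have h2 : (∑ j ∈ Finset.range (r + 1), (-1 : ℝ) ^ j * (r.choose j : ℝ)) = 0 := by
      exact_mod_cast h1
    have h3 : fdiff f 0 r x =
        (-1) ^ r * ((∑ j ∈ Finset.range (r + 1), (-1 : ℝ) ^ j * (r.choose j : ℝ)) * f x) := by
      simp only [fdiff, smul_zero, add_zero, pow_add, Finset.sum_mul, Finset.mul_sum, mul_assoc]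
    rw [h3, h2, zero_mul, mul_zero]
  have htotal : ∑ k ∈ Finset.range (r + 1), (-1 : ℝ) ^ k * (r.choose k : ℝ) *
      (fdiff f ((k : ℝ) • s) r (x + (k : ℝ) • h) - fdiff f (h + (k : ℝ) • s) r x) = 0 := by
    simp only [mul_sub, Finset.sum_sub_distrib, sub_eq_zero, fdiff, Finset.mul_sum]
    rw [Finset.sum_comm]
    refine Finset.sum_congr rfl fun j _ => Finset.sum_congr rfl fun k _ => ?_
    have : x + (k : ℝ) • h + (j : ℝ) • (k : ℝ) • s = x + (k : ℝ) • (h + (j : ℝ) • s) := by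
      module
    rw [this]
    ring
  rw [Finset.range_eq_Ico, Finset.sum_eq_sum_Ico_succ_bot (by omega)] at htotal
  simp only [Nat.cast_zero, zero_smul, add_zero, hzero, pow_zero, Nat.choose_zero_right,
    Nat.cast_one, zero_sub, one_mul, zero_add] at htotal
  have : Finset.Ico 1 (r + 1) = Finset.Icc 1 r := by ext; simp
  rw [this] at htotal
  linarith

theorem abs_fdiff_reverse (f : EuclideanSpace ℝ (Fin n) → ℝ) (η w : EuclideanSpace ℝ (Fin n))
    {r : ℕ} (hr : 0 < r) :
    |fdiff f ((r : ℝ)⁻¹ • (w - η)) r η| = |fdiff f ((r : ℝ)⁻¹ • (η - w)) r w| := by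
  have hr' : (r : ℝ) ≠ 0 := by positivity
  have key : fdiff f ((r : ℝ)⁻¹ • (w - η)) r η
      = (-1) ^ r * fdiff f ((r : ℝ)⁻¹ • (η - w)) r w := by
    unfold fdiff
    rw [← Finset.sum_range_reflect, Finset.mul_sum]
    refine Finset.sum_congr rfl fun j hj => ?_
    have hj' : j ≤ r := by simpa [Nat.lt_succ_iff] using hj
    have e : r + 1 - 1 - j = r - j := by omega
    have harg : η + ((r - j : ℕ) : ℝ) • (r : ℝ)⁻¹ • (w - η)
        = w + (j : ℝ) • (r : ℝ)⁻¹ • (η - w) := by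
      rw [Nat.cast_sub hj']
      match_scalars <;> field_simp <;> ring
    have hsign : (-1 : ℝ) ^ (r + (r - j)) = (-1) ^ r * (-1) ^ (r + j) := by
      rw [← pow_add, show r + (r + j) = r + (r - j) + 2 * j by omega, pow_add _ _ (2 * j), pow_mul]
      simp
    rw [e, harg, Nat.choose_symm hj', hsign]
    ring
  rw [key, abs_mul]
  simp

/-- Whitney's identity as an estimate by differences along segments from points of `[x, x + rh]`
to points obtained from `z` by contractions centred at `x` and `x + rh`. -/
theorem ofReal_abs_fdiff_le (f : EuclideanSpace ℝ (Fin n) → ℝ) (x h z : EuclideanSpace ℝ (Fin n))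
    {r : ℕ} (hr : 0 < r) :
    ENNReal.ofReal |fdiff f h r x| ≤ ∑ k ∈ Finset.Icc 1 r, (2 : ℝ≥0∞) ^ r *
      (ENNReal.ofReal |fdiff f ((r : ℝ)⁻¹ • (x + (k : ℝ) • h - AffineMap.lineMap x z (k / r : ℝ)))
          r (AffineMap.lineMap x z (k / r : ℝ))| +
        ENNReal.ofReal |fdiff f ((r : ℝ)⁻¹ • (x - AffineMap.lineMap (x + (r : ℝ) • h) z (k / r : ℝ)))
          r (AffineMap.lineMap (x + (r : ℝ) • h) z (k / r : ℝ))|) := by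
  have hr' : (r : ℝ) ≠ 0 := by positivity
  rw [fdiff_eq_sum_fdiff_sub f x h (((r : ℝ)⁻¹ * (r : ℝ)⁻¹) • (z - x - (r : ℝ) • h)) hr]
  refine (ENNReal.ofReal_le_ofReal (Finset.abs_sum_le_sum_abs _ _)).trans ?_
  rw [ENNReal.ofReal_sum_of_nonneg fun _ _ => abs_nonneg _]
  refine Finset.sum_le_sum fun k _ => ?_
  have e1 : (r : ℝ)⁻¹ • (AffineMap.lineMap x z (k / r : ℝ) - (x + (k : ℝ) • h))
      = (k : ℝ) • ((r : ℝ)⁻¹ * (r : ℝ)⁻¹) • (z - x - (r : ℝ) • h) := by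
    rw [AffineMap.lineMap_apply_module]
    match_scalars <;> field_simp <;> ring
  have e2 : (r : ℝ)⁻¹ • (AffineMap.lineMap (x + (r : ℝ) • h) z (k / r : ℝ) - x)
      = h + (k : ℝ) • ((r : ℝ)⁻¹ * (r : ℝ)⁻¹) • (z - x - (r : ℝ) • h) := by
    rw [AffineMap.lineMap_apply_module]
    match_scalars <;> field_simp <;> ring
  rw [← abs_fdiff_reverse f (x + (k : ℝ) • h) _ hr, ← abs_fdiff_reverse f x _ hr, e1, e2, abs_mul,
    abs_mul, abs_pow, abs_neg, abs_one, one_pow, one_mul, Nat.abs_cast,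
    ENNReal.ofReal_mul (by positivity), ENNReal.ofReal_natCast,
    ← ENNReal.ofReal_add (abs_nonneg _) (abs_nonneg _)]
  gcongr
  · exact_mod_cast Nat.choose_le_two_pow r k
  · exact abs_sub _ _

theorem sum_rpow_le_card_rpow_mul_sum {ι : Type*} (s : Finset ι) (a : ι → ℝ≥0∞) {q : ℝ}
    (hq : 0 < q) : (∑ i ∈ s, a i) ^ q ≤ (s.card : ℝ≥0∞) ^ q * ∑ i ∈ s, a i ^ q := by
  rcases s.eq_empty_or_nonempty with rfl | hs
  · simp [hq]
  obtain ⟨i, hi, hmax⟩ := s.exists_max_image a hs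
  calc (∑ j ∈ s, a j) ^ q ≤ ((s.card : ℝ≥0∞) * a i) ^ q := by
        gcongr
        simpa using Finset.sum_le_card_nsmul s a (a i) hmax
    _ = (s.card : ℝ≥0∞) ^ q * a i ^ q := ENNReal.mul_rpow_of_nonneg _ _ hq.le
    _ ≤ _ := by
        gcongr
        exact Finset.single_le_sum (f := fun j => a j ^ q) (fun _ _ => zero_le) hi

theorem lintegral_comp_lineMap {E : Type*} [NormedAddCommGroup E] [NormedSpace ℝ E]
    [FiniteDimensional ℝ E] [MeasurableSpace E] [BorelSpace E] (μ : Measure E) [μ.IsAddHaarMeasure]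
    (φ : E → ℝ≥0∞) (hφ : Measurable φ) (a : E) {c : ℝ} (hc : c ≠ 0) :
    ∫⁻ z, φ (AffineMap.lineMap a z c) ∂μ
      = ENNReal.ofReal |(c ^ Module.finrank ℝ E)⁻¹| * ∫⁻ z, φ z ∂μ := by
  have hm : Measurable fun z => φ ((1 - c) • a + z) := by fun_prop
  simp only [AffineMap.lineMap_apply_module]
  rw [← lintegral_map (f := fun z => φ ((1 - c) • a + z)) (g := fun z => c • z) hm (by fun_prop),
    Measure.map_addHaar_smul μ hc, lintegral_smul_measure, lintegral_add_left_eq_self, smul_eq_mul]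

/-- The pairs `(ξ, η)` such that the half-open segment `(η, ξ]` is contained in `O`. -/
def visiblePairs {E : Type*} [AddCommGroup E] [Module ℝ E] (O : Set E) : Set (E × E) :=
  {y | ∀ t ∈ Set.Ioc (0 : ℝ) 1, AffineMap.lineMap y.2 y.1 t ∈ O}

theorem measurableSet_visiblePairs {E : Type*} [NormedAddCommGroup E] [NormedSpace ℝ E]
    [SecondCountableTopology E] [MeasurableSpace E] [BorelSpace E] {O : Set E} (hO : IsOpen O) :
    MeasurableSet (visiblePairs O) := by
  have hInter : visiblePairs O =
      ⋂ m : ℕ, {y | ∀ t ∈ Set.Icc (1 / ((m : ℝ) + 1)) 1, AffineMap.lineMap y.2 y.1 t ∈ O} := by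
    ext y
    simp only [visiblePairs, Set.mem_ofPred_eq, Set.mem_iInter]
    constructor
    · intro hy m t ht
      exact hy t ⟨lt_of_lt_of_le (by positivity) ht.1, ht.2⟩
    · intro hy t ht
      obtain ⟨m, hm⟩ := exists_nat_one_div_lt ht.1
      exact hy m t ⟨hm.le, ht.2⟩
  rw [hInter]
  refine MeasurableSet.iInter fun m => IsOpen.measurableSet ?_
  refine isOpen_iff_mem_nhds.2 fun y hy => ?_
  refine isCompact_Icc.eventually_forall_of_forall_eventually
    (P := fun (y : E × E) (t : ℝ) => AffineMap.lineMap y.2 y.1 t ∈ O) fun t ht => ?_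
  have hcont : Continuous fun z : (E × E) × ℝ => (AffineMap.lineMap z.1.2 z.1.1 z.2 : E) := by
    simp only [AffineMap.lineMap_apply_module]
    fun_prop
  exact hcont.continuousAt.eventually (hO.mem_nhds (hy t ht))

theorem segment_subset_of_mem_visiblePairs {E : Type*} [NormedAddCommGroup E] [NormedSpace ℝ E]
    {A : Set E} {ξ η : E} (h : (ξ, η) ∈ visiblePairs (interior A)) (hη : η ∈ A) :
    segment ℝ ξ η ⊆ A := by
  rw [segment_symm, segment_eq_image_lineMap]
  rintro _ ⟨t, ht, rfl⟩
  rcases ht.1.eq_or_lt with rfl | h0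
  · simpa using hη
  · exact interior_subset (h t ⟨h0, ht.2⟩)

theorem Convex.lineMap_mem_interior {E : Type*} [NormedAddCommGroup E] [NormedSpace ℝ E]
    {A : Set E} (hA : Convex ℝ A) {a z : E} (ha : a ∈ A) (hz : z ∈ interior A) {t : ℝ}
    (ht : t ∈ Set.Ioc (0 : ℝ) 1) : AffineMap.lineMap a z t ∈ interior A := by
  rw [AffineMap.lineMap_apply_module]
  exact hA.combo_self_interior_mem_interior ha hz (by linarith [ht.2]) ht.1 (by ring)

/-- The average on the right-hand side, with the condition `[ξ, η] ⊆ E` replaced by a Borel one. -/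
def visibleIntegral (f : EuclideanSpace ℝ (Fin n) → ℝ) (E : Set (EuclideanSpace ℝ (Fin n)))
    (r : ℕ) (q : ℝ) (η : EuclideanSpace ℝ (Fin n)) : ℝ≥0∞ :=
  ∫⁻ ξ, (visiblePairs (interior E) ∩ Prod.snd ⁻¹' E).indicator
    (fun y => (ENNReal.ofReal |fdiff f ((r : ℝ)⁻¹ • (y.2 - y.1)) r y.1|) ^ q) (ξ, η)

theorem measurable_visibleIntegrand {f : EuclideanSpace ℝ (Fin n) → ℝ} (hf : Measurable f)
    {E : Set (EuclideanSpace ℝ (Fin n))} (hE : MeasurableSet E) (r : ℕ) (q : ℝ) :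
    Measurable ((visiblePairs (interior E) ∩ Prod.snd ⁻¹' E).indicator
    (fun y : EuclideanSpace ℝ (Fin n) × EuclideanSpace ℝ (Fin n) =>
      (ENNReal.ofReal |fdiff f ((r : ℝ)⁻¹ • (y.2 - y.1)) r y.1|) ^ q)) := by
  refine Measurable.indicator ?_
    ((measurableSet_visiblePairs isOpen_interior).inter (measurable_snd hE))
  unfold fdiff
  fun_prop

theorem measurable_visibleIntegral {f : EuclideanSpace ℝ (Fin n) → ℝ} (hf : Measurable f)
    {E : Set (EuclideanSpace ℝ (Fin n))} (hE : MeasurableSet E) (r : ℕ) (q : ℝ) :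
    Measurable (visibleIntegral f E r q) :=
  (measurable_visibleIntegrand hf hE r q).lintegral_prod_left'

theorem visibleIntegral_le (f : EuclideanSpace ℝ (Fin n) → ℝ)
    {E : Set (EuclideanSpace ℝ (Fin n))} (hE : MeasurableSet E) {r : ℕ} (hr : 0 < r) {q : ℝ}
    (η : EuclideanSpace ℝ (Fin n)) :
    visibleIntegral f E r q η ≤
      ∫⁻ ξ in E, (ENNReal.ofReal |fdiffOn f E ((r : ℝ)⁻¹ • (η - ξ)) r ξ|) ^ q := by
  have hr' : (r : ℝ) ≠ 0 := by positivity
  rw [← lintegral_indicator hE]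
  refine lintegral_mono fun ξ => ?_
  by_cases hy : (ξ, η) ∈ visiblePairs (interior E) ∩ Prod.snd ⁻¹' E
  · have hseg := segment_subset_of_mem_visiblePairs hy.1 hy.2
    have hend : ξ + (r : ℝ) • (r : ℝ)⁻¹ • (η - ξ) = η := by
      rw [smul_inv_smul₀ hr']; abel
    rw [Set.indicator_of_mem hy, Set.indicator_of_mem (hseg (left_mem_segment ℝ ξ η)), fdiffOn,
      hend, if_pos hseg]
  · rw [Set.indicator_of_notMem hy]
    exact zero_le

/-- A contraction of a convex set `A ⊆ E` towards one of its points keeps the integral over `A`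
of differences along segments to a point of `A` below a multiple of the integral over `E`. -/
theorem setLIntegral_lineMap_le {f : EuclideanSpace ℝ (Fin n) → ℝ} (hf : Measurable f)
    {E A : Set (EuclideanSpace ℝ (Fin n))} (hE : MeasurableSet E) (hAE : A ⊆ E)
    (hA : Convex ℝ A) {a η : EuclideanSpace ℝ (Fin n)} (ha : a ∈ A) (hη : η ∈ A)
    {r k : ℕ} (hk : k ∈ Finset.Icc 1 r) (q : ℝ) :
    ∫⁻ z in interior A, (ENNReal.ofReal |fdiff f ((r : ℝ)⁻¹ • (η -
        AffineMap.lineMap a z (k / r : ℝ))) r (AffineMap.lineMap a z (k / r : ℝ))|) ^ q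
      ≤ (r : ℝ≥0∞) ^ n * visibleIntegral f E r q η := by
  rw [Finset.mem_Icc] at hk
  have hk0 : (1 : ℝ) ≤ k := by exact_mod_cast hk.1
  have hkr : (k : ℝ) ≤ r := by exact_mod_cast hk.2
  have hr0 : (0 : ℝ) < r := by linarith
  have hc : (k / r : ℝ) ∈ Set.Ioc (0 : ℝ) 1 := ⟨by positivity, (div_le_one hr0).2 hkr⟩
  have hslice := (measurable_visibleIntegrand hf hE r q).comp
    (measurable_id.prodMk (measurable_const (a := η)))
  calc _ ≤ ∫⁻ z in interior A, (visiblePairs (interior E) ∩ Prod.snd ⁻¹' E).indicator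
          (fun y => (ENNReal.ofReal |fdiff f ((r : ℝ)⁻¹ • (y.2 - y.1)) r y.1|) ^ q)
          (AffineMap.lineMap a z (k / r : ℝ), η) := by
        refine setLIntegral_mono' isOpen_interior.measurableSet fun z hz => ?_
        have hw := hA.lineMap_mem_interior ha hz hc
        rw [Set.indicator_of_mem]
        exact ⟨fun t ht => interior_mono hAE (hA.lineMap_mem_interior hη hw ht), hAE hη⟩
    _ ≤ ∫⁻ z, (visiblePairs (interior E) ∩ Prod.snd ⁻¹' E).indicator
          (fun y => (ENNReal.ofReal |fdiff f ((r : ℝ)⁻¹ • (y.2 - y.1)) r y.1|) ^ q)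
          (AffineMap.lineMap a z (k / r : ℝ), η) := setLIntegral_le_lintegral _ _
    _ = ENNReal.ofReal |((k / r : ℝ) ^ n)⁻¹| * visibleIntegral f E r q η := by
        have := lintegral_comp_lineMap volume _ hslice a hc.1.ne'
        rw [finrank_euclideanSpace_fin] at this
        exact this
    _ ≤ _ := by
        gcongr
        rw [← ENNReal.ofReal_natCast, ← ENNReal.ofReal_pow hr0.le]
        refine ENNReal.ofReal_le_ofReal ?_
        rw [← inv_pow, inv_div, abs_pow, abs_of_nonneg (by positivity)]
        gcongr
        exact div_le_self hr0.le hk0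

theorem add_smul_mem_segment {E : Type*} [AddCommGroup E] [Module ℝ E] (x h : E) {r k : ℕ}
    (hr : 0 < r) (hk : k ∈ Finset.range (r + 1)) :
    x + (k : ℝ) • h ∈ segment ℝ x (x + (r : ℝ) • h) := by
  have hr0 : (0 : ℝ) < r := by exact_mod_cast hr
  have hk' : (k : ℝ) ≤ r := by exact_mod_cast Nat.lt_succ_iff.1 (Finset.mem_range.1 hk)
  rw [segment_eq_image_lineMap]
  refine ⟨k / r, ⟨by positivity, (div_le_one hr0).2 hk'⟩, ?_⟩
  rw [AffineMap.lineMap_apply_module]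
  match_scalars <;> field_simp
  ring

theorem volume_mul_fdiff_rpow_le {f : EuclideanSpace ℝ (Fin n) → ℝ} (hf : Measurable f)
    {E A : Set (EuclideanSpace ℝ (Fin n))} (hE : MeasurableSet E) (hAE : A ⊆ E)
    (hA : Convex ℝ A) {x h : EuclideanSpace ℝ (Fin n)} {r : ℕ} (hr : 0 < r)
    (hseg : segment ℝ x (x + (r : ℝ) • h) ⊆ A) {q : ℝ} (hq : 0 < q) :
    volume A * (ENNReal.ofReal |fdiff f h r x|) ^ q ≤
      ((2 : ℝ≥0∞) ^ r * (2 * r)) ^ q * ((r : ℝ≥0∞) ^ n * r) *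
        ∑ k ∈ Finset.range (r + 1), visibleIntegral f E r q (x + (k : ℝ) • h) := by
  have hmem : ∀ k ∈ Finset.range (r + 1), x + (k : ℝ) • h ∈ A := fun k hk =>
    hseg (add_smul_mem_segment x h hr hk)
  have hx : x ∈ A := hseg (left_mem_segment ℝ _ _)
  have hxr : x + (r : ℝ) • h ∈ A := hseg (right_mem_segment ℝ _ _)
  set u : ℕ → EuclideanSpace ℝ (Fin n) → ℝ≥0∞ := fun k z =>
    ENNReal.ofReal |fdiff f ((r : ℝ)⁻¹ • (x + (k : ℝ) • h - AffineMap.lineMap x z (k / r : ℝ)))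
          r (AffineMap.lineMap x z (k / r : ℝ))| with hu
  set v : ℕ → EuclideanSpace ℝ (Fin n) → ℝ≥0∞ := fun k z =>
    ENNReal.ofReal |fdiff f ((r : ℝ)⁻¹ • (x - AffineMap.lineMap (x + (r : ℝ) • h) z (k / r : ℝ)))
          r (AffineMap.lineMap (x + (r : ℝ) • h) z (k / r : ℝ))| with hv
  have hum : ∀ k, Measurable (u k) := by
    intro k
    simp only [hu, fdiff, AffineMap.lineMap_apply_module]
    fun_prop
  have hvm : ∀ k, Measurable (v k) := by
    intro k
    simp only [hv, fdiff, AffineMap.lineMap_apply_module]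
    fun_prop
  have hpoint : ∀ z, (ENNReal.ofReal |fdiff f h r x|) ^ q ≤
      ((2 : ℝ≥0∞) ^ r * (2 * r)) ^ q * ∑ k ∈ Finset.Icc 1 r, (u k z ^ q + v k z ^ q) := by
    intro z
    have hpair : ∀ a b : ℝ≥0∞, (a + b) ^ q ≤ 2 ^ q * (a ^ q + b ^ q) := fun a b => by
      simpa using sum_rpow_le_card_rpow_mul_sum Finset.univ ![a, b] hq
    calc _ ≤ (∑ k ∈ Finset.Icc 1 r, (2 : ℝ≥0∞) ^ r * (u k z + v k z)) ^ q := by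
          gcongr
          exact ofReal_abs_fdiff_le f x h z hr
      _ ≤ ((2 : ℝ≥0∞) ^ r) ^ q * ((r : ℝ≥0∞) ^ q *
            ∑ k ∈ Finset.Icc 1 r, 2 ^ q * (u k z ^ q + v k z ^ q)) := by
          rw [← Finset.mul_sum, ENNReal.mul_rpow_of_nonneg _ _ hq.le]
          gcongr
          refine (sum_rpow_le_card_rpow_mul_sum _ _ hq).trans ?_
          rw [Nat.card_Icc, Nat.add_sub_cancel]
          gcongr
          exact hpair _ _
      _ = _ := by
          rw [← Finset.mul_sum, ENNReal.mul_rpow_of_nonneg _ _ hq.le,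
            ENNReal.mul_rpow_of_nonneg _ _ hq.le]
          ring
  set J := visibleIntegral f E r q with hJ
  have hvol : volume (interior A) = volume A := by
    refine le_antisymm (measure_mono interior_subset) ?_
    calc volume A ≤ volume (interior A ∪ frontier A) :=
          measure_mono (by rw [← closure_eq_interior_union_frontier]; exact subset_closure)
      _ ≤ volume (interior A) + volume (frontier A) := measure_union_le _ _
      _ = volume (interior A) := by rw [hA.addHaar_frontier volume, add_zero]
  calc volume A * (ENNReal.ofReal |fdiff f h r x|) ^ q
      = ∫⁻ _ in interior A, (ENNReal.ofReal |fdiff f h r x|) ^ q := by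
        rw [setLIntegral_const, hvol, mul_comm]
    _ ≤ ∫⁻ z in interior A, ((2 : ℝ≥0∞) ^ r * (2 * r)) ^ q *
          ∑ k ∈ Finset.Icc 1 r, (u k z ^ q + v k z ^ q) := lintegral_mono hpoint
    _ = ((2 : ℝ≥0∞) ^ r * (2 * r)) ^ q * ∑ k ∈ Finset.Icc 1 r,
          ((∫⁻ z in interior A, u k z ^ q) + ∫⁻ z in interior A, v k z ^ q) := by
        rw [lintegral_const_mul _ (by fun_prop), lintegral_finsetSum _ (by fun_prop)]
        congr 1
        refine Finset.sum_congr rfl fun k _ => ?_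
        rw [lintegral_add_left (by fun_prop)]
    _ ≤ ((2 : ℝ≥0∞) ^ r * (2 * r)) ^ q * ∑ k ∈ Finset.Icc 1 r,
          ((r : ℝ≥0∞) ^ n * J (x + (k : ℝ) • h) + (r : ℝ≥0∞) ^ n * J x) := by
        gcongr with k hk
        · exact setLIntegral_lineMap_le hf hE hAE hA hx
            (hmem k (by simp only [Finset.mem_Icc, Finset.mem_range] at *; omega)) hk q
        · exact setLIntegral_lineMap_le hf hE hAE hA hxr hx hk q
    _ ≤ ((2 : ℝ≥0∞) ^ r * (2 * r)) ^ q * ((r : ℝ≥0∞) ^ n * (r *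
          ∑ k ∈ Finset.range (r + 1), J (x + (k : ℝ) • h))) := by
        gcongr
        simp only [← mul_add, ← Finset.mul_sum]
        gcongr
        rw [Finset.sum_add_distrib, Finset.sum_const, Nat.card_Icc, Nat.add_sub_cancel,
          Finset.range_eq_Ico, Finset.sum_eq_sum_Ico_succ_bot (by omega), nsmul_eq_mul, mul_add,
          add_comm]
        have hIco : Finset.Ico (0 + 1) (r + 1) = Finset.Icc 1 r := by ext; simp
        rw [hIco]
        simp only [Nat.cast_zero, zero_smul, add_zero]
        gcongr
        refine le_mul_of_one_le_left zero_le ?_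
        exact_mod_cast hr
    _ = _ := by ring

/-- The constant of the main estimate. -/
def differenceConst (d r : ℕ) (q : ℝ) : ℝ≥0 :=
  2 ^ r * (2 * r) * ((r ^ d * r * (r + 1)) * (r + 1)) ^ (max 1 (1 / q))

/-- Lemma `lem-9-1:Dec`, Dai–Prymak.
Pointwise differences over `S` are controlled by averaged differences over `E`, provided
each segment `[ξ, ξ+rh]` in `S` lies in a convex subset `E^ξ ⊆ E` of proportional measure. -/
theorem statement18 (d : ℕ) (r : ℕ) (hr : 0 < r) :
    ∃ C : ℝ → ℝ≥0, (∀ q, 0 < C q) ∧ (∀ q q', 1 ≤ q → 1 ≤ q' → C q = C q') ∧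
      ∀ q p : ℝ, 0 < q → q ≤ p →
      ∀ h : EuclideanSpace ℝ (Fin d), ∀ δ₀ : ℝ, δ₀ ∈ Set.Ioo (0 : ℝ) 1 →
      ∀ S E : Set (EuclideanSpace ℝ (Fin d)), MeasurableSet S → MeasurableSet E →
        0 < volume E → volume E < ⊤ →
        (∀ ξ ∈ S, segment ℝ ξ (ξ + (r : ℝ) • h) ⊆ S →
          ∃ Eξ : Set (EuclideanSpace ℝ (Fin d)), Eξ ⊆ E ∧ Convex ℝ Eξ ∧
            ENNReal.ofReal δ₀ * volume E ≤ volume Eξ ∧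
            segment ℝ ξ (ξ + (r : ℝ) • h) ⊆ Eξ) →
      ∀ f : EuclideanSpace ℝ (Fin d) → ℝ, Measurable f →
        eLpNorm (fdiffOn f S h r) (ENNReal.ofReal p) (volume.restrict S) ≤
          (C q : ℝ≥0∞) *
            (∫⁻ η in S, ((ENNReal.ofReal δ₀ * volume E)⁻¹ *
                ∫⁻ ξ in E,
                  (ENNReal.ofReal |fdiffOn f E ((r : ℝ)⁻¹ • (η - ξ)) r ξ|) ^ q) ^ (p / q)) ^
              (1 / p) := by
  refine ⟨differenceConst d r, fun q => ?_, fun q q' hq hq' => ?_, ?_⟩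
  · unfold differenceConst
    have : (0 : ℝ≥0) < r := by positivity
    refine mul_pos (by positivity) (NNReal.rpow_pos (by positivity))
  · have hmax : ∀ t : ℝ, 1 ≤ t → max 1 (1 / t) = 1 := fun t ht =>
      max_eq_left ((div_le_one (by linarith)).2 ht)
    simp only [differenceConst, hmax q hq, hmax q' hq']
  intro q p hq hqp h δ₀ hδ S E hS hE hE0 hEtop hconv f hf
  have hp : 0 < p := hq.trans_le hqp
  have hpq : 0 < p / q := by positivity
  set V : ℝ≥0∞ := ENNReal.ofReal δ₀ * volume E with hV
  have hV0 : V ≠ 0 := mul_ne_zero (by simpa using hδ.1) hE0.ne'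
  have hVtop : V ≠ ⊤ := ENNReal.mul_ne_top ENNReal.ofReal_ne_top hEtop.ne
  set B : ℝ≥0∞ := (2 : ℝ≥0∞) ^ r * (2 * r) with hB
  set K : ℝ≥0∞ := (r : ℝ≥0∞) ^ d * r * (r + 1) with hK
  set J := visibleIntegral f E r q with hJ
  have hJm : Measurable J := measurable_visibleIntegral hf hE r q
  set Φ : EuclideanSpace ℝ (Fin d) → ℝ≥0∞ := S.indicator fun η => (V⁻¹ * J η) ^ (p / q) with hΦ
  have hΦm : Measurable Φ := Measurable.indicator (by fun_prop) hS
  have hpoint : ∀ x ∈ S, ‖fdiffOn f S h r x‖ₑ ^ p ≤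
      B ^ p * K ^ (p / q) * ∑ k ∈ Finset.range (r + 1), Φ (x + (k : ℝ) • h) := by
    intro x hx
    by_cases hseg : segment ℝ x (x + (r : ℝ) • h) ⊆ S
    swap
    · simp [fdiffOn, hseg, hp]
    obtain ⟨A, hAE, hA, hvolA, hsegA⟩ := hconv x hx hseg
    have hΦeq : ∀ k ∈ Finset.range (r + 1), Φ (x + (k : ℝ) • h)
        = (V⁻¹ * J (x + (k : ℝ) • h)) ^ (p / q) := fun k hk =>
      Set.indicator_of_mem (hseg (add_smul_mem_segment x h hr hk)) _
    have hmain : (ENNReal.ofReal |fdiff f h r x|) ^ q ≤ B ^ q * ((r : ℝ≥0∞) ^ d * r) *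
        ∑ k ∈ Finset.range (r + 1), V⁻¹ * J (x + (k : ℝ) • h) := by
      have h1 := (mul_le_mul_left hvolA _).trans
        (volume_mul_fdiff_rpow_le hf hE hAE hA hr hsegA hq)
      calc _ = V⁻¹ * (V * (ENNReal.ofReal |fdiff f h r x|) ^ q) := by
            rw [← mul_assoc, ENNReal.inv_mul_cancel hV0 hVtop, one_mul]
        _ ≤ V⁻¹ * (B ^ q * ((r : ℝ≥0∞) ^ d * r) *
              ∑ k ∈ Finset.range (r + 1), J (x + (k : ℝ) • h)) := by gcongr
        _ = _ := by rw [← Finset.mul_sum]; ring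
    rw [fdiffOn, if_pos hseg, Real.enorm_eq_ofReal_abs, Finset.sum_congr rfl hΦeq]
    calc (ENNReal.ofReal |fdiff f h r x|) ^ p
        = ((ENNReal.ofReal |fdiff f h r x|) ^ q) ^ (p / q) := by
          rw [← ENNReal.rpow_mul, mul_div_cancel₀ _ hq.ne']
      _ ≤ (B ^ q * ((r : ℝ≥0∞) ^ d * r) *
            ∑ k ∈ Finset.range (r + 1), V⁻¹ * J (x + (k : ℝ) • h)) ^ (p / q) := by
          gcongr
      _ ≤ B ^ p * ((r : ℝ≥0∞) ^ d * r) ^ (p / q) * ((r + 1 : ℝ≥0∞) ^ (p / q) *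
            ∑ k ∈ Finset.range (r + 1), (V⁻¹ * J (x + (k : ℝ) • h)) ^ (p / q)) := by
          rw [ENNReal.mul_rpow_of_nonneg _ _ hpq.le, ENNReal.mul_rpow_of_nonneg _ _ hpq.le,
            ← ENNReal.rpow_mul B, mul_div_cancel₀ _ hq.ne']
          gcongr
          simpa using sum_rpow_le_card_rpow_mul_sum (Finset.range (r + 1))
            (fun k => V⁻¹ * J (x + (k : ℝ) • h)) hpq
      _ = _ := by
          rw [hK, ENNReal.mul_rpow_of_nonneg (_ * _) (_ + _) hpq.le]
          ring
  have hint : ∫⁻ x in S, ‖fdiffOn f S h r x‖ₑ ^ p ≤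
      B ^ p * K ^ (p / q) * ((r + 1) * ∫⁻ η in S, (V⁻¹ * J η) ^ (p / q)) := by
    calc _ ≤ ∫⁻ x in S, B ^ p * K ^ (p / q) *
          ∑ k ∈ Finset.range (r + 1), Φ (x + (k : ℝ) • h) := setLIntegral_mono' hS hpoint
      _ ≤ ∫⁻ x, B ^ p * K ^ (p / q) *
          ∑ k ∈ Finset.range (r + 1), Φ (x + (k : ℝ) • h) := setLIntegral_le_lintegral _ _
      _ = B ^ p * K ^ (p / q) * ∑ _k ∈ Finset.range (r + 1), ∫⁻ x, Φ x := by
          rw [lintegral_const_mul _ (by fun_prop), lintegral_finsetSum _ (by fun_prop)]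
          simp only [lintegral_add_right_eq_self]
      _ = _ := by
          rw [Finset.sum_const, Finset.card_range, nsmul_eq_mul, hΦ, lintegral_indicator hS]
          push_cast
          rfl
  have hK1 : (1 : ℝ≥0∞) ≤ K := by
    have h1 : (1 : ℝ≥0∞) ≤ r := by exact_mod_cast hr
    exact one_le_mul (one_le_mul (one_le_pow₀ h1) h1) (by simp)
  have hC : (differenceConst d r q : ℝ≥0∞) = B * (K * (r + 1)) ^ (max 1 (1 / q)) := by
    rw [differenceConst, ENNReal.coe_mul, ENNReal.coe_rpow_of_nonneg _ (by positivity)]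
    push_cast
    rfl
  have hconst : B * K ^ (1 / q) * (r + 1 : ℝ≥0∞) ^ (1 / p) ≤ differenceConst d r q := by
    rw [hC, ENNReal.mul_rpow_of_nonneg K _ (by positivity), ← mul_assoc]
    exact mul_le_mul' (mul_le_mul' le_rfl (ENNReal.rpow_le_rpow_of_exponent_le hK1 (le_max_right _ _)))
      (ENNReal.rpow_le_rpow_of_exponent_le (by simp)
        ((one_div_le_one_div_of_le hq hqp).trans (le_max_right _ _)))
  rw [eLpNorm_eq_lintegral_rpow_enorm_toReal (by simpa using hp) ENNReal.ofReal_ne_top,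
    ENNReal.toReal_ofReal hp.le]
  calc _ ≤ (B ^ p * K ^ (p / q) * ((r + 1) * ∫⁻ η in S, (V⁻¹ * J η) ^ (p / q))) ^ (1 / p) := by
        gcongr
    _ = B * K ^ (1 / q) * (r + 1 : ℝ≥0∞) ^ (1 / p) *
          (∫⁻ η in S, (V⁻¹ * J η) ^ (p / q)) ^ (1 / p) := by
        have hp' : (0 : ℝ) ≤ 1 / p := by positivity
        rw [ENNReal.mul_rpow_of_nonneg _ _ hp', ENNReal.mul_rpow_of_nonneg _ _ hp',
          ENNReal.mul_rpow_of_nonneg _ _ hp', ← ENNReal.rpow_mul, ← ENNReal.rpow_mul,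
          mul_one_div_cancel hp.ne', ENNReal.rpow_one, show p / q * (1 / p) = 1 / q by field_simp]
        ring
    _ ≤ _ := by
        gcongr with η
        exact visibleIntegral_le f hE hr η
end
end
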